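/- Let d ≥ 3 be an integer and let u be a classical finite-energy free Coulomb wave on ℝ^d with energy E. Then lim_{t→+∞} ∫_{ℝ^d} (|∇ₓu(x,t)|² + |u(x,t)|²/|x|) dx = E, lim_{t→+∞} ∫_{ℝ^d} |∇ₓu(x,t)|² dx = E, and lim_{t→+∞} ∫_{ℝ^d} |∂ₜu(x,t)|² dx = E. -/

import Mathlib

open MeasureTheory Filter

/-- The Laplacian of `u : ℝ^d → ℝ`, as the sum of second derivatives in the
coordinate directions. -/
noncomputable def lap {d : ℕ} (u : EuclideanSpace ℝ (Fin d) → ℝ)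
    (x : EuclideanSpace ℝ (Fin d)) : ℝ :=
  ∑ i : Fin d, iteratedFDeriv ℝ 2 u x ![EuclideanSpace.single i 1, EuclideanSpace.single i 1]

/-- The energy density `e(x,t) = ½|∇ₓu|² + ½|∂ₜu|² + |u|²/(2|x|)` of the free
Coulomb wave equation. -/
noncomputable def eDenFree {d : ℕ} (u : EuclideanSpace ℝ (Fin d) → ℝ → ℝ)
    (x : EuclideanSpace ℝ (Fin d)) (t : ℝ) : ℝ :=
  (1 / 2) * ‖gradient (fun y => u y t) x‖ ^ 2
    + (1 / 2) * (deriv (u x) t) ^ 2 + (u x t) ^ 2 / (2 * ‖x‖)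

/-- `u` is a classical finite-energy free Coulomb wave with (conserved)
energy `E`: it is continuous on `ℝ^d × ℝ`, `C²` on `(ℝ^d∖{0}) × ℝ`, solves
`∂ₜ²u - Δu + u/|x| = 0` away from `x = 0`, and its total energy equals `E`
at every time. -/
def IsFreeCoulombWave {d : ℕ} (u : EuclideanSpace ℝ (Fin d) → ℝ → ℝ) (E : ℝ) : Prop :=
  Continuous (fun q : EuclideanSpace ℝ (Fin d) × ℝ => u q.1 q.2) ∧
  ContDiffOn ℝ 2 (fun q : EuclideanSpace ℝ (Fin d) × ℝ => u q.1 q.2)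
    ({(0 : EuclideanSpace ℝ (Fin d))}ᶜ ×ˢ Set.univ) ∧
  (∀ x : EuclideanSpace ℝ (Fin d), x ≠ 0 → ∀ t : ℝ,
    deriv (deriv (u x)) t - lap (fun y => u y t) x + u x t / ‖x‖ = 0) ∧
  (∀ t : ℝ, Integrable (fun x => eDenFree u x t)) ∧
  (∀ t : ℝ, ∫ x, eDenFree u x t = E)

namespace CoulombWave

open Set Topology

/-- Euclidean space `ℝ^d`. -/
abbrev Sp (d : ℕ) : Type := EuclideanSpace ℝ (Fin d)

/-- The `i`-th coordinate direction of space, as a vector of space-time. -/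
noncomputable def ex {d : ℕ} (i : Fin d) : Sp d × ℝ := (EuclideanSpace.single i 1, 0)

/-- The time direction of space-time. -/
def et {d : ℕ} : Sp d × ℝ := (0, 1)

/-- The partial derivative in the `i`-th space direction. -/
noncomputable def dx {d : ℕ} (F : Sp d × ℝ → ℝ) (i : Fin d) (q : Sp d × ℝ) : ℝ :=
  fderiv ℝ F q (ex i)

/-- The partial derivative in time. -/
noncomputable def dt {d : ℕ} (F : Sp d × ℝ → ℝ) (q : Sp d × ℝ) : ℝ :=
  fderiv ℝ F q et

variable {d : ℕ}

lemma hasDerivAt_time {F : Sp d × ℝ → ℝ} {x : Sp d} {t : ℝ}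
    (hF : DifferentiableAt ℝ F (x, t)) : HasDerivAt (fun s => F (x, s)) (dt F (x, t)) t := by
  have h1 : HasDerivAt (fun s : ℝ => ((x, s) : Sp d × ℝ)) (0, 1) t :=
    (hasDerivAt_const t x).prodMk (hasDerivAt_id t)
  exact hF.hasFDerivAt.comp_hasDerivAt t h1

lemma hasFDerivAt_space {F : Sp d × ℝ → ℝ} {x : Sp d} {t : ℝ}
    (hF : DifferentiableAt ℝ F (x, t)) :
    HasFDerivAt (fun y => F (y, t))
      ((fderiv ℝ F (x, t)).comp (ContinuousLinearMap.inl ℝ (Sp d) ℝ)) x := by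
  have h1 : HasFDerivAt (fun y : Sp d => ((y, t) : Sp d × ℝ))
      (ContinuousLinearMap.inl ℝ (Sp d) ℝ) x := hasFDerivAt_prodMk_left x t
  exact hF.hasFDerivAt.comp x h1

lemma eventually_mem_slab {a b t : ℝ} {x : Sp d} {K : Set (Sp d)} (hK : IsClosed K) (hx : x ∉ K)
    (ht : t ∈ Ioo (a - 1) (b + 1)) :
    ∀ᶠ q : Sp d × ℝ in 𝓝 (x, t), q.1 ∉ K ∧ q.2 ∈ Ioo (a - 1) (b + 1) := by
  have : Kᶜ ×ˢ Ioo (a - 1) (b + 1) ∈ 𝓝 (x, t) :=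
    (hK.isOpen_compl.prod isOpen_Ioo).mem_nhds ⟨hx, ht⟩
  filter_upwards [this] with q hq using hq

lemma fderiv_eq_zero_off {F : Sp d × ℝ → ℝ} {a b t : ℝ} {x : Sp d} {K : Set (Sp d)}
    (hK : IsClosed K) (h0 : ∀ x ∉ K, ∀ t ∈ Ioo (a - 1) (b + 1), F (x, t) = 0) (hx : x ∉ K)
    (ht : t ∈ Ioo (a - 1) (b + 1)) : fderiv ℝ F (x, t) = 0 := by
  have : F =ᶠ[𝓝 (x, t)] fun _ => 0 := by
    filter_upwards [eventually_mem_slab hK hx ht] with q hq using h0 q.1 hq.1 q.2 hq.2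
  rw [this.fderiv_eq]; simp

lemma continuousAt_fderiv_apply {F : Sp d × ℝ → ℝ} {q : Sp d × ℝ} (hF : ContDiffAt ℝ 1 F q)
    (w : Sp d × ℝ) : ContinuousAt (fun q => fderiv ℝ F q w) q :=
  ((hF.fderiv_right (m := 0) (by norm_num)).continuousAt).clm_apply continuousAt_const

lemma integrable_of_compact {f : Sp d → ℝ} {K : Set (Sp d)} (hK : IsCompact K)
    (hf : Continuous f) (h0 : ∀ x ∉ K, f x = 0) : Integrable f :=
  hf.integrable_of_hasCompactSupport (HasCompactSupport.intro hK h0)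

lemma integral_dx_eq_zero {F : Sp d × ℝ → ℝ} {a b t : ℝ} {K : Set (Sp d)}
    (hK : IsCompact K) (hF : ∀ x, ∀ t ∈ Ioo (a - 1) (b + 1), ContDiffAt ℝ 1 F (x, t))
    (h0 : ∀ x ∉ K, ∀ t ∈ Ioo (a - 1) (b + 1), F (x, t) = 0) (ht : t ∈ Ioo (a - 1) (b + 1))
    (i : Fin d) :
    Integrable (fun x => dx F i (x, t)) ∧ ∫ x, dx F i (x, t) = 0 := by
  have hd : ∀ x, DifferentiableAt ℝ F (x, t) := fun x => (hF x t ht).differentiableAt (by norm_num)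
  have hc : Continuous (fun x => dx F i (x, t)) := by
    refine continuous_iff_continuousAt.2 fun x => ?_
    exact (continuousAt_fderiv_apply (hF x t ht) (ex i)).comp
      (f := fun y : Sp d => ((y, t) : Sp d × ℝ)) (by fun_prop)
  have hi : Integrable (fun x => dx F i (x, t)) :=
    integrable_of_compact hK hc fun x hx => by
      simp [dx, fderiv_eq_zero_off hK.isClosed h0 hx ht]
  refine ⟨hi, ?_⟩
  have hfd : ∀ x, fderiv ℝ (fun y => F (y, t)) x (EuclideanSpace.single i 1) = dx F i (x, t) := by
    intro x
    rw [(hasFDerivAt_space (hd x)).fderiv]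
    simp [dx, ex]
  have hFc : Continuous (fun x => F (x, t)) := by
    refine continuous_iff_continuousAt.2 fun x => ?_
    exact (hd x).continuousAt.comp (f := fun y : Sp d => ((y, t) : Sp d × ℝ)) (by fun_prop)
  have hF1 : Integrable (fun x => F (x, t)) :=
    integrable_of_compact hK hFc fun x hx => h0 x hx t ht
  have := integral_mul_fderiv_eq_neg_fderiv_mul_of_integrable (μ := (volume : Measure (Sp d)))
    (f := fun _ => (1 : ℝ)) (g := fun y => F (y, t)) (v := EuclideanSpace.single i 1)
    (by simp) (by simpa [hfd] using hi) (by simpa using hF1) (by simp)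
    (fun x _ => (hasFDerivAt_space (hd x)).differentiableAt)
  simpa [hfd] using this

lemma integral_dt {W : Sp d × ℝ → ℝ} {a b : ℝ} (hab : a ≤ b) {K : Set (Sp d)}
    (hK : IsCompact K) (hW : ∀ x, ∀ t ∈ Ioo (a - 1) (b + 1), ContDiffAt ℝ 1 W (x, t))
    (h0 : ∀ x ∉ K, ∀ t ∈ Ioo (a - 1) (b + 1), W (x, t) = 0) :
    (∫ x, W (x, b)) - ∫ x, W (x, a) = ∫ t in a..b, ∫ x, dt W (x, t) := by
  have hsub : ∀ t ∈ Icc a b, t ∈ Ioo (a - 1) (b + 1) := fun t ht =>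
    ⟨by linarith [ht.1], by linarith [ht.2]⟩
  have hd : ∀ x, ∀ t ∈ Icc a b, DifferentiableAt ℝ W (x, t) :=
    fun x t ht => (hW x t (hsub t ht)).differentiableAt (by norm_num)
  have hint : ∀ t ∈ Icc a b, Integrable (fun x => W (x, t)) := by
    intro t ht
    refine integrable_of_compact hK (continuous_iff_continuousAt.2 fun x => ?_)
      fun x hx => h0 x hx t (hsub t ht)
    exact (hd x t ht).continuousAt.comp (f := fun y : Sp d => ((y, t) : Sp d × ℝ)) (by fun_prop)
  have hct : ∀ x, ∀ t ∈ Icc a b, ContinuousAt (dt W) (x, t) :=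
    fun x t ht => continuousAt_fderiv_apply (hW x t (hsub t ht)) et
  have hprod : Integrable (Function.uncurry fun t x => dt W (x, t))
      ((volume.restrict (Set.uIoc a b)).prod (volume : Measure (Sp d))) := by
    have h1 : IntegrableOn (Function.uncurry fun t x => dt W (x, t)) (Icc a b ×ˢ K)
        ((volume : Measure ℝ).prod (volume : Measure (Sp d))) := by
      refine ContinuousOn.integrableOn_compact (isCompact_Icc.prod hK) ?_
      rintro ⟨t, x⟩ ⟨ht, -⟩
      exact ((hct x t ht).comp (f := fun y : ℝ × Sp d => ((y.2, y.1) : Sp d × ℝ))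
        (by fun_prop)).continuousWithinAt
    have h2 : IntegrableOn (Function.uncurry fun t x => dt W (x, t)) (Icc a b ×ˢ univ)
        ((volume : Measure ℝ).prod (volume : Measure (Sp d))) := by
      refine IntegrableOn.of_forall_sdiff_eq_zero h1 (measurableSet_Icc.prod MeasurableSet.univ) ?_
      rintro ⟨t, x⟩ ⟨⟨ht, -⟩, hn⟩
      have hx : x ∉ K := fun hx => hn ⟨ht, hx⟩
      simp [dt, fderiv_eq_zero_off hK.isClosed h0 hx (hsub t ht)]
    have h3 := h2.mono_set (s := Set.uIoc a b ×ˢ univ)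
      (by rw [Set.uIoc_of_le hab]; exact prod_mono Ioc_subset_Icc_self subset_rfl)
    rwa [IntegrableOn, ← Measure.prod_restrict, Measure.restrict_univ] at h3
  rw [intervalIntegral_integral_swap hprod, ← integral_sub (hint b ⟨hab, le_rfl⟩)
    (hint a ⟨le_rfl, hab⟩)]
  congr 1
  ext x
  refine (intervalIntegral.integral_eq_sub_of_hasDerivAt (f := fun t => W (x, t)) ?_ ?_).symm
  · intro t ht
    rw [uIcc_of_le hab] at ht
    exact hasDerivAt_time (hd x t ht)
  · refine ContinuousOn.intervalIntegrable fun t ht => ?_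
    rw [uIcc_of_le hab] at ht
    exact ((hct x t ht).comp (f := fun s : ℝ => ((x, s) : Sp d × ℝ))
        (by fun_prop)).continuousWithinAt

/-- The divergence theorem in space-time for fields with bounded spatial support. -/
lemma spacetime_divergence {W : Sp d × ℝ → ℝ} {F : Fin d → Sp d × ℝ → ℝ} {a b : ℝ} (hab : a ≤ b)
    {K : Set (Sp d)} (hK : IsCompact K)
    (hW : ∀ x, ∀ t ∈ Ioo (a - 1) (b + 1), ContDiffAt ℝ 1 W (x, t))
    (hW0 : ∀ x ∉ K, ∀ t ∈ Ioo (a - 1) (b + 1), W (x, t) = 0)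
    (hF : ∀ i x, ∀ t ∈ Ioo (a - 1) (b + 1), ContDiffAt ℝ 1 (F i) (x, t))
    (hF0 : ∀ i, ∀ x ∉ K, ∀ t ∈ Ioo (a - 1) (b + 1), F i (x, t) = 0) :
    (∫ x, W (x, b)) - ∫ x, W (x, a) =
      ∫ t in a..b, ∫ x, (dt W (x, t) - ∑ i, dx (F i) i (x, t)) := by
  rw [integral_dt hab hK hW hW0]
  refine intervalIntegral.integral_congr fun t ht => ?_
  rw [uIcc_of_le hab] at ht
  have hts : t ∈ Ioo (a - 1) (b + 1) := ⟨by linarith [ht.1], by linarith [ht.2]⟩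
  have hc : Continuous (fun x => dt W (x, t)) := by
    refine continuous_iff_continuousAt.2 fun x => ?_
    exact (continuousAt_fderiv_apply (hW x t hts) et).comp
      (f := fun y : Sp d => ((y, t) : Sp d × ℝ)) (by fun_prop)
  have hi : Integrable (fun x => dt W (x, t)) :=
    integrable_of_compact hK hc fun x hx => by
      simp [dt, fderiv_eq_zero_off hK.isClosed hW0 hx hts]
  have hs := fun i => integral_dx_eq_zero hK (hF i) (hF0 i) hts i
  rw [integral_sub hi (integrable_finsetSum _ fun i _ => (hs i).1),
    integral_finsetSum _ fun i _ => (hs i).1]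
  simp [fun i => (hs i).2]

/-- The squared length of the spatial gradient. -/
noncomputable def gsq (U : Sp d × ℝ → ℝ) (q : Sp d × ℝ) : ℝ := ∑ i, dx U i q ^ 2

/-- The energy density, as a function on space-time. -/
noncomputable def en (U : Sp d × ℝ → ℝ) (q : Sp d × ℝ) : ℝ :=
  (1 / 2) * gsq U q + (1 / 2) * dt U q ^ 2 + U q ^ 2 / (2 * ‖q.1‖)

/-- A finite-energy free Coulomb wave, described by space-time partial derivatives. -/
structure Wave (U : Sp d × ℝ → ℝ) (E : ℝ) : Prop where
  cont : Continuous U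
  smooth : ∀ x t, x ≠ 0 → ContDiffAt ℝ 2 U (x, t)
  pde : ∀ x t, x ≠ 0 → dt (dt U) (x, t) = ∑ i, dx (dx U i) i (x, t) - U (x, t) / ‖x‖
  integrable : ∀ t, Integrable (fun x => en U (x, t))
  energy : ∀ t, ∫ x, en U (x, t) = E

lemma contDiffAt_partial {U : Sp d × ℝ → ℝ} {q : Sp d × ℝ} (h : ContDiffAt ℝ 2 U q)
    (w : Sp d × ℝ) : ContDiffAt ℝ 1 (fun q => fderiv ℝ U q w) q :=
  (h.fderiv_right (m := 1) (by norm_num)).clm_apply contDiffAt_const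

lemma norm_gradient_sq {U : Sp d × ℝ → ℝ} {x : Sp d} {t : ℝ} (h : DifferentiableAt ℝ U (x, t)) :
    ‖gradient (fun y => U (y, t)) x‖ ^ 2 = gsq U (x, t) := by
  rw [EuclideanSpace.norm_sq_eq, gsq]
  refine Finset.sum_congr rfl fun i _ => ?_
  have h1 : gradient (fun y => U (y, t)) x i = dx U i (x, t) := by
    have h2 : gradient (fun y => U (y, t)) x i
        = inner ℝ (gradient (fun y => U (y, t)) x) (EuclideanSpace.single i (1 : ℝ)) := by
      rw [EuclideanSpace.inner_single_right]; simp
    rw [h2, gradient, InnerProductSpace.toDual_symm_apply, (hasFDerivAt_space h).fderiv]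
    simp [dx, ex]
  rw [h1, Real.norm_eq_abs, sq_abs]

lemma deriv_time {U : Sp d × ℝ → ℝ} {x : Sp d} {t : ℝ} (h : DifferentiableAt ℝ U (x, t)) :
    deriv (fun s => U (x, s)) t = dt U (x, t) := (hasDerivAt_time h).deriv

lemma lap_eq {U : Sp d × ℝ → ℝ} (hU : ∀ x t, x ≠ 0 → ContDiffAt ℝ 2 U (x, t)) {x : Sp d} {t : ℝ}
    (hx : x ≠ 0) : lap (fun y => U (y, t)) x = ∑ i, dx (dx U i) i (x, t) := by
  refine Finset.sum_congr rfl fun i _ => ?_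
  have hf : ContDiffAt ℝ 2 (fun y => U (y, t)) x :=
    (hU x t hx).comp (f := fun y : Sp d => ((y, t) : Sp d × ℝ)) x (by fun_prop)
  have hd : DifferentiableAt ℝ (fderiv ℝ (fun y => U (y, t))) x :=
    (hf.fderiv_right (m := 1) (by norm_num)).differentiableAt (by norm_num)
  have h1 : fderiv ℝ (fun z => fderiv ℝ (fun y => U (y, t)) z (EuclideanSpace.single i 1)) x
      (EuclideanSpace.single i 1) = fderiv ℝ (fderiv ℝ (fun y => U (y, t))) x
      (EuclideanSpace.single i 1) (EuclideanSpace.single i 1) := by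
    rw [fderiv_clm_apply hd (differentiableAt_const _)]
    simp
  have h2 : (fun z => fderiv ℝ (fun y => U (y, t)) z (EuclideanSpace.single i 1)) =ᶠ[𝓝 x]
      fun z => dx U i (z, t) := by
    filter_upwards [isOpen_ne.mem_nhds hx] with z hz
    rw [(hasFDerivAt_space ((hU z t hz).differentiableAt (by norm_num))).fderiv]
    simp [dx, ex]
  rw [iteratedFDeriv_two_apply]
  simp only [Matrix.cons_val_zero, Matrix.cons_val_one]
  rw [← h1, h2.fderiv_eq, (hasFDerivAt_space
    ((contDiffAt_partial (hU x t hx) (ex i)).differentiableAt (by norm_num)) :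
      HasFDerivAt (fun z => dx U i (z, t)) _ x).fderiv]
  simp [dx, ex]

lemma ae_ne_zero (hd : 3 ≤ d) : ∀ᵐ x : Sp d, x ≠ 0 := by
  have : Nonempty (Fin d) := ⟨⟨0, by omega⟩⟩
  simp [ae_iff]

lemma Wave.of_isFreeCoulombWave (hd : 3 ≤ d) {u : Sp d → ℝ → ℝ} {E : ℝ}
    (hu : IsFreeCoulombWave u E) : Wave (fun q => u q.1 q.2) E := by
  obtain ⟨hc, h2, hp, hi, he⟩ := hu
  set U : Sp d × ℝ → ℝ := fun q => u q.1 q.2 with hU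
  have hs : ∀ x t, x ≠ 0 → ContDiffAt ℝ 2 U (x, t) := by
    intro x t hx
    refine h2.contDiffAt ?_
    exact ((isOpen_compl_singleton).prod isOpen_univ).mem_nhds ⟨hx, mem_univ _⟩
  have hdf : ∀ x t, x ≠ 0 → DifferentiableAt ℝ U (x, t) := fun x t hx =>
    (hs x t hx).differentiableAt (by norm_num)
  have hen : ∀ t, (fun x => eDenFree u x t) =ᵐ[volume] fun x => en U (x, t) := by
    intro t
    filter_upwards [ae_ne_zero hd] with x hx
    have h1 := norm_gradient_sq (hdf x t hx)
    have h3 := deriv_time (hdf x t hx)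
    simp only [eDenFree, en]
    rw [← h1, ← h3]
  refine ⟨hc, hs, ?_, fun t => (hi t).congr (hen t), fun t => ?_⟩
  · intro x t hx
    have h1 := hp x hx t
    have h3 : deriv (u x) = fun s => dt U (x, s) := funext fun s => deriv_time (hdf x s hx)
    have h4 := deriv_time (U := dt U) (x := x) (t := t)
      ((contDiffAt_partial (hs x t hx) et).differentiableAt (by norm_num))
    have h5 := lap_eq hs (t := t) hx
    rw [h3, h4] at h1
    change _ - lap (fun y => U (y, t)) x + U (x, t) / ‖x‖ = 0 at h1
    rw [h5] at h1
    linarith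
  · rw [← he t, integral_congr_ae (hen t)]

/-- `F` is differentiable at `q`, with derivative `F'` in direction `w`. -/
def HD (w q : Sp d × ℝ) (F : Sp d × ℝ → ℝ) (F' : ℝ) : Prop :=
  DifferentiableAt ℝ F q ∧ fderiv ℝ F q w = F'

namespace HD

variable {w q : Sp d × ℝ} {A B : Sp d × ℝ → ℝ} {A' B' : ℝ}

lemma congr (hA : HD w q A A') (h : A' = B') : HD w q A B' := h ▸ hA

lemma of_contDiffAt (hA : ContDiffAt ℝ 1 A q) : HD w q A (fderiv ℝ A q w) :=
  ⟨hA.differentiableAt (by norm_num), rfl⟩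

lemma add (hA : HD w q A A') (hB : HD w q B B') : HD w q (fun p => A p + B p) (A' + B') := by
  refine ⟨hA.1.add hB.1, ?_⟩
  have := (hA.1.hasFDerivAt.add hB.1.hasFDerivAt).fderiv
  rw [← hA.2, ← hB.2]
  exact congrArg (fun L => L w) this

lemma sub (hA : HD w q A A') (hB : HD w q B B') : HD w q (fun p => A p - B p) (A' - B') := by
  refine ⟨hA.1.sub hB.1, ?_⟩
  have := (hA.1.hasFDerivAt.sub hB.1.hasFDerivAt).fderiv
  rw [← hA.2, ← hB.2]
  exact congrArg (fun L => L w) this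

lemma mul (hA : HD w q A A') (hB : HD w q B B') :
    HD w q (fun p => A p * B p) (A' * B q + A q * B') := by
  refine ⟨hA.1.mul hB.1, ?_⟩
  have := congrArg (fun L => L w) (hA.1.hasFDerivAt.mul hB.1.hasFDerivAt).fderiv
  rw [← hA.2, ← hB.2]
  refine this.trans ?_
  simp; ring

lemma const (c : ℝ) : HD w q (fun _ => c) 0 := ⟨differentiableAt_const _, by simp⟩

lemma comp (hA : HD w q A A') {φ : ℝ → ℝ} {φ' : ℝ} (hφ : HasDerivAt φ φ' (A q)) :
    HD w q (fun p => φ (A p)) (φ' * A') := by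
  have h := hφ.comp_hasFDerivAt q hA.1.hasFDerivAt
  refine ⟨h.differentiableAt, ?_⟩
  rw [← hA.2]
  exact congrArg (fun L => L w) h.fderiv

lemma sq (hA : HD w q A A') : HD w q (fun p => A p ^ 2) (2 * A q * A') := by
  have := hA.comp (φ := fun y => y ^ 2) (hasDerivAt_pow 2 (A q))
  simpa using this

lemma sum {ι : Type*} {s : Finset ι} {A : ι → Sp d × ℝ → ℝ} {A' : ι → ℝ}
    (h : ∀ i, HD w q (A i) (A' i)) : HD w q (fun p => ∑ i ∈ s, A i p) (∑ i ∈ s, A' i) := by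
  classical
  induction s using Finset.induction_on with
  | empty => simpa using const 0
  | insert i s hi ih => simpa [Finset.sum_insert hi] using (h i).add ih

end HD

/-- The squared spatial radius. -/
noncomputable def sr (q : Sp d × ℝ) : ℝ := ‖q.1‖ ^ 2

lemma sr_pos {q : Sp d × ℝ} (hq : q.1 ≠ 0) : 0 < sr q := by
  have := norm_pos_iff.2 hq
  unfold sr; positivity

lemma sr_eq_sum (q : Sp d × ℝ) : sr q = ∑ i, q.1 i ^ 2 := by
  simp [sr, EuclideanSpace.norm_sq_eq]

lemma contDiff_sr : ContDiff ℝ 1 (sr : Sp d × ℝ → ℝ) := contDiff_fst.norm_sq ℝ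

lemma contDiff_coord (i : Fin d) : ContDiff ℝ 1 (fun q : Sp d × ℝ => q.1 i) :=
  (EuclideanSpace.proj (𝕜 := ℝ) i : Sp d →L[ℝ] ℝ).contDiff.comp contDiff_fst

lemma hd_coord (w q : Sp d × ℝ) (i : Fin d) : HD w q (fun q => q.1 i) (w.1 i) := by
  have h : HasFDerivAt (fun q : Sp d × ℝ => q.1 i)
      ((EuclideanSpace.proj (𝕜 := ℝ) i : Sp d →L[ℝ] ℝ).comp
        (ContinuousLinearMap.fst ℝ (Sp d) ℝ)) q :=
    ((EuclideanSpace.proj (𝕜 := ℝ) i : Sp d →L[ℝ] ℝ).comp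
      (ContinuousLinearMap.fst ℝ (Sp d) ℝ)).hasFDerivAt
  exact ⟨h.differentiableAt, by rw [h.fderiv]; simp⟩

lemma hd_sr (w q : Sp d × ℝ) : HD w q sr (2 * ∑ i, q.1 i * w.1 i) := by
  have := HD.sum (s := Finset.univ) fun i => (hd_coord w q i).sq
  have h : (sr : Sp d × ℝ → ℝ) = fun q => ∑ i, q.1 i ^ 2 := funext sr_eq_sum
  rw [h]
  refine this.congr ?_
  rw [Finset.mul_sum]
  exact Finset.sum_congr rfl fun i _ => by ring

lemma hd_sr_ex (q : Sp d × ℝ) (i : Fin d) : HD (ex i) q sr (2 * q.1 i) :=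
  (hd_sr _ q).congr (by simp [ex])

lemma hd_sr_et (q : Sp d × ℝ) : HD et q sr 0 := (hd_sr _ q).congr (by simp [et])

lemma hd_norm {w q : Sp d × ℝ} (hq : q.1 ≠ 0) {s' : ℝ} (h : HD w q sr s') :
    HD w q (fun q => ‖q.1‖) (s' / (2 * ‖q.1‖)) := by
  have h1 := h.comp (Real.hasDerivAt_sqrt (sr_pos hq).ne')
  have h2 : (fun p : Sp d × ℝ => √(sr p)) = fun q => ‖q.1‖ := by
    ext p; exact Real.sqrt_sq (norm_nonneg _)
  rw [h2] at h1
  refine h1.congr ?_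
  rw [show √(sr q) = ‖q.1‖ from Real.sqrt_sq (norm_nonneg _)]
  ring

lemma partial_comm {U : Sp d × ℝ → ℝ} {q : Sp d × ℝ} (h : ContDiffAt ℝ 2 U q)
    (v w : Sp d × ℝ) : fderiv ℝ (fun q => fderiv ℝ U q v) q w
      = fderiv ℝ (fun q => fderiv ℝ U q w) q v := by
  have hd : DifferentiableAt ℝ (fderiv ℝ U) q :=
    (h.fderiv_right (m := 1) (by norm_num)).differentiableAt (by norm_num)
  rw [fderiv_clm_apply hd (differentiableAt_const _), fderiv_clm_apply hd (differentiableAt_const _)]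
  simpa using (h.isSymmSndFDerivAt (by simp)) w v

/-- Radial profiles `g`, `h` together with their derivatives `g1`, `h1`, `h2` on `(0,∞)`. -/
structure Profile (g g1 h h1 h2 : ℝ → ℝ) : Prop where
  hg : ∀ s, 0 < s → HasDerivAt g (g1 s) s
  hh : ∀ s, 0 < s → HasDerivAt h (h1 s) s
  hh1 : ∀ s, 0 < s → HasDerivAt h1 (h2 s) s
  cg1 : ContinuousOn g1 (Ioi 0)
  ch2 : ContinuousOn h2 (Ioi 0)
  mg : Measurable g
  mg1 : Measurable g1
  mh : Measurable h
  mh1 : Measurable h1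
  mh2 : Measurable h2

lemma contDiffAt_of_hasDerivAt {f f' : ℝ → ℝ} (h : ∀ s, 0 < s → HasDerivAt f (f' s) s)
    (hc : ContinuousOn f' (Ioi 0)) {s : ℝ} (hs : 0 < s) : ContDiffAt ℝ 1 f s := by
  have h1 : ContDiffOn ℝ 1 f (Ioi 0) := by
    rw [show (1 : WithTop ℕ∞) = 0 + 1 by norm_num, contDiffOn_succ_iff_deriv_of_isOpen isOpen_Ioi]
    refine ⟨fun s hs => (h s hs).differentiableAt.differentiableWithinAt, by simp, ?_⟩
    rw [contDiffOn_zero]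
    exact hc.congr fun s hs => (h s hs).deriv
  exact h1.contDiffAt (isOpen_Ioi.mem_nhds hs)

namespace Profile

variable {g g1 h h1 h2 : ℝ → ℝ}

lemma contDiffAt_g (p : Profile g g1 h h1 h2) {s : ℝ} (hs : 0 < s) : ContDiffAt ℝ 1 g s :=
  contDiffAt_of_hasDerivAt p.hg p.cg1 hs

lemma contDiffAt_h1 (p : Profile g g1 h h1 h2) {s : ℝ} (hs : 0 < s) : ContDiffAt ℝ 1 h1 s :=
  contDiffAt_of_hasDerivAt p.hh1 p.ch2 hs

lemma contDiffAt_h (p : Profile g g1 h h1 h2) {s : ℝ} (hs : 0 < s) : ContDiffAt ℝ 1 h s :=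
  contDiffAt_of_hasDerivAt p.hh
    (fun _ hs => (p.contDiffAt_h1 hs).continuousAt.continuousWithinAt) hs

end Profile

/-- The derivative of `U` along the position vector. -/
noncomputable def rad (U : Sp d × ℝ → ℝ) (q : Sp d × ℝ) : ℝ := ∑ j, q.1 j * dx U j q

/-- The momentum density of the radial multiplier `g x·∇ + h`. -/
noncomputable def mom (U : Sp d × ℝ → ℝ) (g h : ℝ → ℝ) (q : Sp d × ℝ) : ℝ :=
  dt U q * (g (sr q) * rad U q + h (sr q) * U q)

/-- The spatial flux of the radial multiplier `g x·∇ + h`. -/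
noncomputable def flux (U : Sp d × ℝ → ℝ) (g h h1 : ℝ → ℝ) (i : Fin d) (q : Sp d × ℝ) : ℝ :=
  q.1 i * (g (sr q) * ((1 / 2) * (dt U q ^ 2 - gsq U q - U q ^ 2 * ‖q.1‖⁻¹))
      - h1 (sr q) * U q ^ 2)
    + dx U i q * (g (sr q) * rad U q + h (sr q) * U q)

/-- The production density of the radial multiplier with profile values `G, G1, H, H1, H2`. -/
noncomputable def dens (U : Sp d × ℝ → ℝ) (q : Sp d × ℝ) (G G1 H H1 H2 : ℝ) : ℝ :=
  (H - (d * G + 2 * sr q * G1) / 2) * dt U q ^ 2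
    - (G + H - (d * G + 2 * sr q * G1) / 2) * gsq U q
    - 2 * G1 * rad U q ^ 2 + (d * H1 + 2 * sr q * H2) * U q ^ 2
    - (H - (d * G + 2 * sr q * G1) / 2 + G / 2) * (U q ^ 2 / ‖q.1‖)

lemma sum_flux_algebra {x p v c S R : Fin d → ℝ} {A a1 a2 a3 m c0 b1 b2 : ℝ}
    (hSR : ∑ i, x i * S i = ∑ i, p i * R i) :
    ∑ i, (A + x i * (2 * x i * a1 + a2 * v i - c0 * S i - a3 * p i) + (c i * m
        + p i * (2 * x i * b1 + c0 * (p i + R i) + b2 * p i)))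
      = d * A + 2 * a1 * ∑ i, x i ^ 2 + a2 * ∑ i, x i * v i
        + (2 * b1 - a3) * ∑ i, x i * p i + m * ∑ i, c i + (c0 + b2) * ∑ i, p i ^ 2 := by
  have : ∀ i, (A + x i * (2 * x i * a1 + a2 * v i - c0 * S i - a3 * p i) + (c i * m
        + p i * (2 * x i * b1 + c0 * (p i + R i) + b2 * p i)))
      = A + 2 * a1 * x i ^ 2 + a2 * (x i * v i) + (2 * b1 - a3) * (x i * p i) + m * c i
        + (c0 + b2) * p i ^ 2 - c0 * (x i * S i) + c0 * (p i * R i) := fun i => by ring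
  simp only [this, Finset.sum_add_distrib, Finset.sum_sub_distrib, ← Finset.mul_sum, hSR]
  simp

variable {U : Sp d × ℝ → ℝ} {E : ℝ}

lemma Wave.contDiffAt_one (hU : Wave U E) {x : Sp d} {t : ℝ} (hx : x ≠ 0) :
    ContDiffAt ℝ 1 U (x, t) := (hU.smooth x t hx).of_le (by norm_num)

lemma Wave.contDiffAt_dx (hU : Wave U E) {x : Sp d} {t : ℝ} (hx : x ≠ 0) (i : Fin d) :
    ContDiffAt ℝ 1 (dx U i) (x, t) := contDiffAt_partial (hU.smooth x t hx) _

lemma Wave.contDiffAt_dt (hU : Wave U E) {x : Sp d} {t : ℝ} (hx : x ≠ 0) :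
    ContDiffAt ℝ 1 (dt U) (x, t) := contDiffAt_partial (hU.smooth x t hx) _

lemma Wave.contDiffAt_gsq (hU : Wave U E) {x : Sp d} {t : ℝ} (hx : x ≠ 0) :
    ContDiffAt ℝ 1 (gsq U) (x, t) :=
  ContDiffAt.sum fun i _ => (hU.contDiffAt_dx hx i).pow 2

lemma Wave.contDiffAt_rad (hU : Wave U E) {x : Sp d} {t : ℝ} (hx : x ≠ 0) :
    ContDiffAt ℝ 1 (rad U) (x, t) :=
  ContDiffAt.sum fun i _ => (contDiff_coord i).contDiffAt.mul (hU.contDiffAt_dx hx i)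

lemma contDiffAt_norm_fst {x : Sp d} {t : ℝ} (hx : x ≠ 0) :
    ContDiffAt ℝ 1 (fun q : Sp d × ℝ => ‖q.1‖) (x, t) :=
  contDiff_fst.contDiffAt.norm ℝ hx

lemma Wave.contDiffAt_en (hU : Wave U E) {x : Sp d} {t : ℝ} (hx : x ≠ 0) :
    ContDiffAt ℝ 1 (en U) (x, t) :=
  ((contDiffAt_const.mul (hU.contDiffAt_gsq hx)).add
    (contDiffAt_const.mul ((hU.contDiffAt_dt hx).pow 2))).add
    (((hU.contDiffAt_one hx).pow 2).div (contDiffAt_const.mul (contDiffAt_norm_fst hx))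
      (by simpa using hx))

lemma contDiffAt_comp_sr {φ : ℝ → ℝ} (hφ : ∀ s, 0 < s → ContDiffAt ℝ 1 φ s) {x : Sp d} {t : ℝ}
    (hx : x ≠ 0) : ContDiffAt ℝ 1 (fun q : Sp d × ℝ => φ (sr q)) (x, t) :=
  (hφ _ (sr_pos (q := (x, t)) hx)).comp (x, t) contDiff_sr.contDiffAt

section

variable {g g1 h h1 h2 : ℝ → ℝ}

lemma Wave.contDiffAt_mom (hU : Wave U E) (p : Profile g g1 h h1 h2) {x : Sp d} {t : ℝ}
    (hx : x ≠ 0) : ContDiffAt ℝ 1 (mom U g h) (x, t) :=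
  (hU.contDiffAt_dt hx).mul
    (((contDiffAt_comp_sr (fun _ hs => p.contDiffAt_g hs) hx).mul (hU.contDiffAt_rad hx)).add
      ((contDiffAt_comp_sr (fun _ hs => p.contDiffAt_h hs) hx).mul (hU.contDiffAt_one hx)))

lemma Wave.contDiffAt_flux (hU : Wave U E) (p : Profile g g1 h h1 h2) {x : Sp d} {t : ℝ}
    (hx : x ≠ 0) (i : Fin d) : ContDiffAt ℝ 1 (flux U g h h1 i) (x, t) :=
  ((contDiff_coord i).contDiffAt.mul
    (((contDiffAt_comp_sr (fun _ hs => p.contDiffAt_g hs) hx).mul (contDiffAt_const.mul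
      ((((hU.contDiffAt_dt hx).pow 2).sub (hU.contDiffAt_gsq hx)).sub
        (((hU.contDiffAt_one hx).pow 2).mul ((contDiffAt_norm_fst hx).inv (by simpa using hx)))))).sub
      ((contDiffAt_comp_sr (fun _ hs => p.contDiffAt_h1 hs) hx).mul
        ((hU.contDiffAt_one hx).pow 2)))).add
  ((hU.contDiffAt_dx hx i).mul
    (((contDiffAt_comp_sr (fun _ hs => p.contDiffAt_g hs) hx).mul (hU.contDiffAt_rad hx)).add
      ((contDiffAt_comp_sr (fun _ hs => p.contDiffAt_h hs) hx).mul (hU.contDiffAt_one hx))))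

/-- The pointwise multiplier identity. -/
lemma Wave.dt_mom_sub_div_flux (hU : Wave U E) (p : Profile g g1 h h1 h2) {x : Sp d} {t : ℝ}
    (hx : x ≠ 0) :
    dt (mom U g h) (x, t) - ∑ i, dx (flux U g h h1 i) i (x, t)
      = dens U (x, t) (g (sr (x, t))) (g1 (sr (x, t))) (h (sr (x, t))) (h1 (sr (x, t)))
          (h2 (sr (x, t))) := by
  set q : Sp d × ℝ := (x, t) with hq
  have hs : 0 < sr q := sr_pos hx
  have hr : ‖x‖ ≠ 0 := norm_ne_zero_iff.2 hx
  have hsr : sr q = ‖x‖ ^ 2 := rfl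
  have hSS := hU.smooth x t hx
  have cU : ∀ w, HD w q U (fderiv ℝ U q w) := fun w => HD.of_contDiffAt (hU.contDiffAt_one hx)
  have cv : ∀ w, HD w q (dt U) (fderiv ℝ (dt U) q w) :=
    fun w => HD.of_contDiffAt (hU.contDiffAt_dt hx)
  have cp : ∀ w i, HD w q (dx U i) (fderiv ℝ (dx U i) q w) :=
    fun w i => HD.of_contDiffAt (hU.contDiffAt_dx hx i)
  have ht : dt (mom U g h) q = dt (dt U) q * (g (sr q) * rad U q + h (sr q) * U q)
      + dt U q * (g (sr q) * ∑ j, x j * dx (dt U) j q + h (sr q) * dt U q) := by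
    have h1 : HD et q (rad U) (∑ j, x j * dx (dt U) j q) := by
      refine (HD.sum (s := Finset.univ) fun j => (hd_coord et q j).mul (cp et j)).congr ?_
      refine Finset.sum_congr rfl fun j _ => ?_
      have : fderiv ℝ (dx U j) q et = dx (dt U) j q := partial_comm hSS _ _
      rw [this]; simp [et, hq]
    have h2 := (cv et).mul ((((hd_sr_et q).comp (p.hg _ hs)).mul h1).add
      (((hd_sr_et q).comp (p.hh _ hs)).mul (cU et)))
    refine h2.2.trans ?_
    simp only [dt]; ring
  have hxi : ∀ i, dx (flux U g h h1 i) i q =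
      (g (sr q) * ((1 / 2) * (dt U q ^ 2 - gsq U q - U q ^ 2 * ‖x‖⁻¹)) - h1 (sr q) * U q ^ 2)
      + x i * (2 * x i * (g1 (sr q) * ((1 / 2) * (dt U q ^ 2 - gsq U q - U q ^ 2 * ‖x‖⁻¹))
            + g (sr q) * (1 / 4) * U q ^ 2 * ‖x‖⁻¹ * (‖x‖⁻¹) ^ 2 - h2 (sr q) * U q ^ 2)
          + (g (sr q) * dt U q) * dx (dt U) i q - g (sr q) * (∑ j, dx U j q * dx (dx U j) i q)
          - (g (sr q) * U q * ‖x‖⁻¹ + 2 * h1 (sr q) * U q) * dx U i q)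
      + (dx (dx U i) i q * (g (sr q) * rad U q + h (sr q) * U q)
        + dx U i q * (2 * x i * (g1 (sr q) * rad U q + h1 (sr q) * U q)
          + g (sr q) * (dx U i q + ∑ j, x j * dx (dx U j) i q) + h (sr q) * dx U i q)) := by
    intro i
    have e1 : HD (ex i) q (fun q => q.1 i) 1 := (hd_coord (ex i) q i).congr (by simp [ex])
    have e2 : HD (ex i) q (rad U) (dx U i q + ∑ j, x j * dx (dx U j) i q) := by
      refine (HD.sum (s := Finset.univ) fun j => (hd_coord (ex i) q j).mul (cp (ex i) j)).congr ?_
      rw [Finset.sum_add_distrib]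
      congr 1
      simp [ex]
    have e3 : HD (ex i) q (gsq U) (2 * ∑ j, dx U j q * dx (dx U j) i q) := by
      refine (HD.sum (s := Finset.univ) fun j => (cp (ex i) j).sq).congr ?_
      rw [Finset.mul_sum]
      exact Finset.sum_congr rfl fun j _ => by simp only [dx]; ring
    have e4 : HD (ex i) q (fun q => ‖q.1‖⁻¹) (-(x i * ‖x‖⁻¹ * (‖x‖⁻¹) ^ 2)) := by
      refine ((hd_norm hx (hd_sr_ex q i)).comp (hasDerivAt_inv hr)).congr ?_
      simp only [hq]; field_simp
    have eg := (hd_sr_ex q i).comp (p.hg _ hs)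
    have eh := (hd_sr_ex q i).comp (p.hh _ hs)
    have eh1 := (hd_sr_ex q i).comp (p.hh1 _ hs)
    have em := (eg.mul e2).add (eh.mul (cU (ex i)))
    have eA := (eg.mul ((HD.const (1 / 2)).mul ((((cv (ex i)).sq.sub e3)).sub
      ((cU (ex i)).sq.mul e4)))).sub (eh1.mul (cU (ex i)).sq)
    refine ((e1.mul eA).add ((cp (ex i) i).mul em)).2.trans ?_
    have f1 : fderiv ℝ (dt U) q (ex i) = dx (dt U) i q := rfl
    have f2 : fderiv ℝ (dx U i) q (ex i) = dx (dx U i) i q := rfl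
    have f3 : fderiv ℝ U q (ex i) = dx U i q := rfl
    have f4 : q.1 = x := rfl
    simp only [f1, f2, f3, f4]
    ring
  have hSR : ∑ i, x i * (∑ j, dx U j q * dx (dx U j) i q)
      = ∑ i, dx U i q * (∑ j, x j * dx (dx U j) i q) := by
    simp only [Finset.mul_sum]
    rw [Finset.sum_comm]
    refine Finset.sum_congr rfl fun i _ => Finset.sum_congr rfl fun j _ => ?_
    have : dx (dx U i) j q = dx (dx U j) i q := partial_comm hSS _ _
    rw [this]; ring
  have hpde := hU.pde x t hx
  rw [← hq] at hpde
  have hx2 : ∑ i, x i ^ 2 = ‖x‖ ^ 2 := (sr_eq_sum q).symm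
  have hrad : ∑ i, x i * dx U i q = rad U q := rfl
  have hgs : ∑ i, dx U i q ^ 2 = gsq U q := rfl
  simp only [hxi]
  rw [sum_flux_algebra hSR, ht, hx2, hrad, hgs, hpde, dens, hsr]
  simp only [hq]
  field_simp
  ring

/-- The multiplier identity for profiles supported in a compact part of `(0,∞)`. -/
lemma Wave.multiplier_identity_of_compact (hd : 3 ≤ d) (hU : Wave U E)
    (p : Profile g g1 h h1 h2) {α β : ℝ} (hα : 0 < α)
    (h0 : ∀ s, s ∉ Icc α β → g s = 0 ∧ h s = 0 ∧ h1 s = 0) {a b : ℝ} (hab : a ≤ b) :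
    (∫ x, mom U g h (x, b)) - ∫ x, mom U g h (x, a)
      = ∫ t in a..b, ∫ x, dens U (x, t) (g (sr (x, t))) (g1 (sr (x, t))) (h (sr (x, t)))
          (h1 (sr (x, t))) (h2 (sr (x, t))) := by
  have hm0 : ∀ q : Sp d × ℝ, sr q ∉ Icc α β → mom U g h q = 0 := by
    intro q hq
    obtain ⟨a1, a2, -⟩ := h0 _ hq
    simp [mom, a1, a2]
  have hf0 : ∀ i, ∀ q : Sp d × ℝ, sr q ∉ Icc α β → flux U g h h1 i q = 0 := by
    intro i q hq
    obtain ⟨a1, a2, a3⟩ := h0 _ hq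
    simp [flux, a1, a2, a3]
  have hnear : ∀ t, ∀ᶠ q : Sp d × ℝ in 𝓝 (0, t), sr q ∉ Icc α β := by
    intro t
    have : ∀ᶠ q : Sp d × ℝ in 𝓝 (0, t), sr q < α :=
      contDiff_sr.continuous.continuousAt.eventually_lt continuousAt_const (by simpa [sr] using hα)
    filter_upwards [this] with q hq hq' using absurd hq'.1 (not_le.2 hq)
  have hfar : ∀ x ∉ Metric.closedBall (0 : Sp d) (|β| + 1), ∀ t : ℝ, sr (x, t) ∉ Icc α β := by
    intro x hx t hs
    have h1 : |β| + 1 < ‖x‖ := by simpa using hx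
    have h2 : ‖x‖ ^ 2 ≤ β := hs.2
    nlinarith [le_abs_self β, abs_nonneg β]
  have := spacetime_divergence (W := mom U g h) (F := flux U g h h1) hab
    (isCompact_closedBall (0 : Sp d) (|β| + 1)) (fun x t _ => ?_)
    (fun x hx t _ => hm0 _ (hfar x hx t)) (fun i x t _ => ?_)
    (fun i x hx t _ => hf0 i _ (hfar x hx t))
  · rw [this]
    refine intervalIntegral.integral_congr fun t _ => integral_congr_ae ?_
    filter_upwards [ae_ne_zero hd] with x hx using hU.dt_mom_sub_div_flux p hx
  · by_cases hx : x = 0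
    · subst hx
      exact (contDiffAt_const (c := (0 : ℝ))).congr_of_eventuallyEq ((hnear t).mono hm0)
    · exact hU.contDiffAt_mom p hx
  · by_cases hx : x = 0
    · subst hx
      exact (contDiffAt_const (c := (0 : ℝ))).congr_of_eventuallyEq ((hnear t).mono (hf0 i))
    · exact hU.contDiffAt_flux p hx i

end

lemma rad_sq_le (U : Sp d × ℝ → ℝ) (q : Sp d × ℝ) : rad U q ^ 2 ≤ sr q * gsq U q := by
  rw [sr_eq_sum]
  exact Finset.sum_mul_sq_le_sq_mul_sq _ _ _

lemma gsq_nonneg (U : Sp d × ℝ → ℝ) (q : Sp d × ℝ) : 0 ≤ gsq U q :=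
  Finset.sum_nonneg fun _ _ => sq_nonneg _

lemma en_nonneg (U : Sp d × ℝ → ℝ) (q : Sp d × ℝ) : 0 ≤ en U q := by
  have := gsq_nonneg U q
  unfold en; positivity

lemma measurable_fderiv_dir (U : Sp d × ℝ → ℝ) (w : Sp d × ℝ) :
    Measurable fun q => fderiv ℝ U q w := measurable_fderiv_apply_const ℝ U w

lemma measurable_gsq (U : Sp d × ℝ → ℝ) : Measurable (gsq U) :=
  Finset.measurable_sum _ fun i _ => (measurable_fderiv_dir U (ex i)).pow_const 2

lemma measurable_dt (U : Sp d × ℝ → ℝ) : Measurable (dt U) := measurable_fderiv_dir U et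

lemma measurable_rad (U : Sp d × ℝ → ℝ) : Measurable (rad U) := by
  refine Finset.measurable_sum _ fun i _ => Measurable.mul ?_ (measurable_fderiv_dir U (ex i))
  exact (contDiff_coord i).continuous.measurable

lemma measurable_sr : Measurable (sr : Sp d × ℝ → ℝ) := contDiff_sr.continuous.measurable

lemma measurable_norm_fst : Measurable (fun q : Sp d × ℝ => ‖q.1‖) := by fun_prop

lemma Wave.measurable_en (hU : Wave U E) : Measurable (en U) :=
  (((measurable_gsq U).const_mul _).add (((measurable_dt U).pow_const 2).const_mul _)).add
    ((hU.cont.measurable.pow_const 2).div (measurable_norm_fst.const_mul 2))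

/-- A smooth cutoff to the shrinking annulus `R + t < |x| < M - t`. -/
noncomputable def annulus (R M : ℝ) (q : Sp d × ℝ) : ℝ :=
  Real.smoothTransition (‖q.1‖ - q.2 - R) * Real.smoothTransition (M - ‖q.1‖ - q.2)

lemma annulus_nonneg (R M : ℝ) (q : Sp d × ℝ) : 0 ≤ annulus R M q :=
  mul_nonneg (Real.smoothTransition.nonneg _) (Real.smoothTransition.nonneg _)

lemma contDiffAt_annulus (R M : ℝ) {x : Sp d} {t : ℝ} (hx : x ≠ 0) :
    ContDiffAt ℝ 1 (annulus R M) (x, t) := by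
  have h1 : ContDiffAt ℝ 1 (fun q : Sp d × ℝ => ‖q.1‖ - q.2 - R) (x, t) :=
    ((contDiffAt_norm_fst hx).sub contDiffAt_snd).sub contDiffAt_const
  have h2 : ContDiffAt ℝ 1 (fun q : Sp d × ℝ => M - ‖q.1‖ - q.2) (x, t) :=
    (contDiffAt_const.sub (contDiffAt_norm_fst hx)).sub contDiffAt_snd
  exact (Real.smoothTransition.contDiffAt.comp (x, t) h1).mul
    (Real.smoothTransition.contDiffAt.comp (x, t) h2)

lemma hd_time (w q : Sp d × ℝ) : HD w q (fun q => q.2) w.2 :=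
  ⟨differentiableAt_snd, by simp [fderiv_snd]⟩

lemma hd_annulus (R M : ℝ) {q : Sp d × ℝ} (hq : q.1 ≠ 0) :
    ∃ ρ σ : ℝ, |ρ| ≤ σ ∧ HD et q (annulus R M) (-σ) ∧
      ∀ i, HD (ex i) q (annulus R M) (ρ * (q.1 i / ‖q.1‖)) := by
  set w := Real.smoothTransition (‖q.1‖ - q.2 - R)
  set k := Real.smoothTransition (M - ‖q.1‖ - q.2)
  set w' := deriv Real.smoothTransition (‖q.1‖ - q.2 - R)
  set k' := deriv Real.smoothTransition (M - ‖q.1‖ - q.2)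
  have hw : 0 ≤ w := Real.smoothTransition.nonneg _
  have hk : 0 ≤ k := Real.smoothTransition.nonneg _
  have hw' : 0 ≤ w' := Real.smoothTransition.monotone.deriv_nonneg
  have hk' : 0 ≤ k' := Real.smoothTransition.monotone.deriv_nonneg
  have hD : ∀ y, HasDerivAt Real.smoothTransition (deriv Real.smoothTransition y) y := fun y =>
    ((Real.smoothTransition.contDiffAt (n := 1)).differentiableAt (by norm_num)).hasDerivAt
  have hgen : ∀ v n' , HD v q (fun q => ‖q.1‖) n' →
      HD v q (annulus R M) (w' * (n' - v.2) * k + w * (k' * (-n' - v.2))) := by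
    intro v n' hn
    have h1 := ((hn.sub (hd_time v q)).sub (HD.const R)).comp (hD _)
    have h2 := (((HD.const M).sub hn).sub (hd_time v q)).comp (hD _)
    exact (h1.mul h2).congr (by simp only [w, k, w', k']; ring)
  have hnt : HD et q (fun q => ‖q.1‖) 0 := (hd_norm hq (hd_sr_et q)).congr (by simp)
  have hnx : ∀ i, HD (ex i) q (fun q => ‖q.1‖) (q.1 i / ‖q.1‖) := fun i =>
    (hd_norm hq (hd_sr_ex q i)).congr (by
      have := norm_ne_zero_iff.2 hq
      field_simp)
  refine ⟨w' * k - w * k', w' * k + w * k', ?_, ?_, fun i => ?_⟩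
  · have := mul_nonneg hw' hk
    have := mul_nonneg hw hk'
    rw [abs_le]; constructor <;> linarith
  · exact (hgen _ _ hnt).congr (by simp [et]; ring)
  · exact (hgen _ _ (hnx i)).congr (by simp [ex]; ring)

lemma Wave.annulus_energy_density_le (hU : Wave U E) (R M : ℝ) {x : Sp d} {t : ℝ} (hx : x ≠ 0) :
    dt (fun q => annulus R M q * en U q) (x, t)
      - ∑ i, dx (fun q => annulus R M q * (dt U q * dx U i q)) i (x, t) ≤ 0 := by
  set q : Sp d × ℝ := (x, t) with hq
  have hr : 0 < ‖x‖ := norm_pos_iff.2 hx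
  have hSS := hU.smooth x t hx
  obtain ⟨ρ, σ, hρσ, ht, hxi⟩ := hd_annulus R M (q := q) hx
  have cU : HD et q U (dt U q) := HD.of_contDiffAt (hU.contDiffAt_one hx)
  have cv : ∀ w, HD w q (dt U) (fderiv ℝ (dt U) q w) :=
    fun w => HD.of_contDiffAt (hU.contDiffAt_dt hx)
  have cp : ∀ w i, HD w q (dx U i) (fderiv ℝ (dx U i) q w) :=
    fun w i => HD.of_contDiffAt (hU.contDiffAt_dx hx i)
  have hen : HD et q (en U) (∑ i, dx U i q * dx (dt U) i q + dt U q * dt (dt U) q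
      + U q * dt U q / ‖x‖) := by
    have e3 : HD et q (gsq U) (2 * ∑ i, dx U i q * dx (dt U) i q) := by
      refine (HD.sum (s := Finset.univ) fun j => (cp et j).sq).congr ?_
      rw [Finset.mul_sum]
      refine Finset.sum_congr rfl fun j _ => ?_
      have : fderiv ℝ (dx U j) q et = dx (dt U) j q := partial_comm hSS _ _
      rw [this]; ring
    have hn : HD et q (fun q => (2 * ‖q.1‖)⁻¹) 0 :=
      (((HD.const 2).mul (hd_norm hx (hd_sr_et q))).comp
        (hasDerivAt_inv (by simpa using hx))).congr (by simp)
    have := (((HD.const (1 / 2)).mul e3).add ((HD.const (1 / 2)).mul (cv et).sq)).add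
      (cU.sq.mul hn)
    refine this.congr ?_
    have f1 : fderiv ℝ (dt U) q et = dt (dt U) q := rfl
    have f4 : q.1 = x := rfl
    rw [f1, f4]
    field_simp
    ring
  have h1 : dt (fun q => annulus R M q * en U q) q = _ := (ht.mul hen).2
  have h2 : ∀ i, dx (fun q => annulus R M q * (dt U q * dx U i q)) i q
      = ρ * (dt U q / ‖x‖) * (x i * dx U i q) + annulus R M q * (dx U i q * dx (dt U) i q)
        + annulus R M q * dt U q * dx (dx U i) i q := by
    intro i
    refine ((hxi i).mul ((cv (ex i)).mul (cp (ex i) i))).2.trans ?_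
    have f1 : fderiv ℝ (dt U) q (ex i) = dx (dt U) i q := rfl
    have f2 : fderiv ℝ (dx U i) q (ex i) = dx (dx U i) i q := rfl
    have f4 : q.1 = x := rfl
    rw [f1, f2, f4]
    ring
  have hpde := hU.pde x t hx
  rw [← hq] at hpde
  have hrad : ∑ i, x i * dx U i q = rad U q := rfl
  rw [h1]
  simp only [h2, Finset.sum_add_distrib, ← Finset.mul_sum, hrad]
  rw [hpde]
  have hcs : (rad U q / ‖x‖) ^ 2 ≤ gsq U q := by
    rw [div_pow, div_le_iff₀ (by positivity), mul_comm]
    exact rad_sq_le U q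
  have hpot : 0 ≤ U q ^ 2 / (2 * ‖x‖) := by positivity
  have hkey : -(ρ * (dt U q * (rad U q / ‖x‖))) ≤ σ * en U q := by
    have hσ : 0 ≤ σ := (abs_nonneg _).trans hρσ
    have h3 : |dt U q * (rad U q / ‖x‖)| ≤ en U q := by
      have : en U q = (1 / 2) * gsq U q + (1 / 2) * dt U q ^ 2 + U q ^ 2 / (2 * ‖x‖) := rfl
      rw [abs_le]
      constructor <;> nlinarith [sq_nonneg (dt U q + rad U q / ‖x‖),
        sq_nonneg (dt U q - rad U q / ‖x‖)]
    calc -(ρ * (dt U q * (rad U q / ‖x‖))) ≤ |ρ * (dt U q * (rad U q / ‖x‖))| := neg_le_abs _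
      _ = |ρ| * |dt U q * (rad U q / ‖x‖)| := abs_mul _ _
      _ ≤ σ * en U q := mul_le_mul hρσ h3 (abs_nonneg _) hσ
  have : ρ * (dt U q / ‖x‖) * rad U q = ρ * (dt U q * (rad U q / ‖x‖)) := by ring
  rw [this]
  have : annulus R M q * (∑ i, dx U i q * dx (dt U) i q + dt U q * (∑ i, dx (dx U i) i q
      - U q / ‖x‖) + U q * dt U q / ‖x‖) = annulus R M q * ∑ i, dx U i q * dx (dt U) i q
      + annulus R M q * dt U q * ∑ i, dx (dx U i) i q := by
    field_simp
    ring
  rw [this]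
  linarith

lemma Wave.annulus_energy_le (hd : 3 ≤ d) (hU : Wave U E) {R M T : ℝ} (hR : 2 ≤ R) (hT : 0 ≤ T) :
    ∫ x, annulus R M (x, T) * en U (x, T) ≤ ∫ x, annulus R M (x, 0) * en U (x, 0) := by
  have h0near : ∀ t ∈ Ioo (0 - 1) (T + 1), ∀ᶠ q : Sp d × ℝ in 𝓝 (0, t), annulus R M q = 0 := by
    intro t ht
    have : ∀ᶠ q : Sp d × ℝ in 𝓝 (0, t), ‖q.1‖ - q.2 - R < 0 :=
      (by fun_prop : Continuous fun q : Sp d × ℝ => ‖q.1‖ - q.2 - R).continuousAt.eventually_lt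
        continuousAt_const (by simp; linarith [ht.1])
    filter_upwards [this] with q hq
    simp [annulus, Real.smoothTransition.zero_of_nonpos hq.le]
  have h0far : ∀ x ∉ Metric.closedBall (0 : Sp d) (|M| + 1), ∀ t ∈ Ioo (0 - 1) (T + 1),
      annulus R M (x, t) = 0 := by
    intro x hx t ht
    have h1 : |M| + 1 < ‖x‖ := by simpa using hx
    have : M - ‖x‖ - t ≤ 0 := by linarith [ht.1, le_abs_self M]
    simp [annulus, Real.smoothTransition.zero_of_nonpos this]
  have := spacetime_divergence (W := fun q => annulus R M q * en U q)
    (F := fun i q => annulus R M q * (dt U q * dx U i q)) hT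
    (isCompact_closedBall (0 : Sp d) (|M| + 1)) (fun x t ht => ?_)
    (fun x hx t ht => by simp [h0far x hx t ht]) (fun i x t ht => ?_)
    (fun i x hx t ht => by simp [h0far x hx t ht])
  · have hle : ∫ t in (0 : ℝ)..T, ∫ x, (dt (fun q => annulus R M q * en U q) (x, t)
        - ∑ i, dx (fun q => annulus R M q * (dt U q * dx U i q)) i (x, t)) ≤ 0 := by
      rw [← neg_nonneg, ← intervalIntegral.integral_neg]
      refine intervalIntegral.integral_nonneg hT fun t _ => ?_
      rw [neg_nonneg]
      refine integral_nonpos_of_ae ?_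
      filter_upwards [ae_ne_zero hd] with x hx using hU.annulus_energy_density_le R M hx
    linarith
  · by_cases hx : x = 0
    · subst hx
      exact (contDiffAt_const (c := (0 : ℝ))).congr_of_eventuallyEq
        ((h0near t ht).mono fun q hq => by simp [hq])
    · exact (contDiffAt_annulus R M hx).mul (hU.contDiffAt_en hx)
  · by_cases hx : x = 0
    · subst hx
      exact (contDiffAt_const (c := (0 : ℝ))).congr_of_eventuallyEq
        ((h0near t ht).mono fun q hq => by simp [hq])
    · exact (contDiffAt_annulus R M hx).mul ((hU.contDiffAt_dt hx).mul (hU.contDiffAt_dx hx i))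

lemma measurable_slice {f : Sp d × ℝ → ℝ} (hf : Measurable f) (t : ℝ) :
    Measurable fun x => f (x, t) := hf.comp measurable_prodMk_right

lemma continuous_smoothTransition_norm (c : ℝ) :
    Continuous fun x : Sp d => Real.smoothTransition (‖x‖ - c) :=
  Real.smoothTransition.continuous.comp (by fun_prop)

/-- Finite speed of propagation of the exterior energy. -/
lemma Wave.exterior_transition_le (hd : 3 ≤ d) (hU : Wave U E) {R T : ℝ} (hR : 2 ≤ R)
    (hT : 0 ≤ T) : ∫ x, Real.smoothTransition (‖x‖ - T - R) * en U (x, T)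
      ≤ ∫ x, Real.smoothTransition (‖x‖ - R) * en U (x, 0) := by
  have hb : ∀ y, ‖Real.smoothTransition y‖ ≤ 1 := fun y => by
    rw [Real.norm_eq_abs, abs_of_nonneg (Real.smoothTransition.nonneg y)]
    exact Real.smoothTransition.le_one y
  have hlim : Tendsto (fun n : ℕ => ∫ x, annulus R n (x, T) * en U (x, T)) atTop
      (𝓝 (∫ x, Real.smoothTransition (‖x‖ - T - R) * en U (x, T))) := by
    refine tendsto_integral_of_dominated_convergence (fun x => en U (x, T)) (fun n => ?_)
      (hU.integrable T) (fun n => Eventually.of_forall fun x => ?_)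
      (Eventually.of_forall fun x => ?_)
    · refine (Continuous.aestronglyMeasurable ?_).mul (hU.integrable T).1
      unfold annulus
      exact (Real.smoothTransition.continuous.comp (by fun_prop)).mul
        (Real.smoothTransition.continuous.comp (by fun_prop))
    · rw [norm_mul, annulus, norm_mul, Real.norm_of_nonneg (en_nonneg U _)]
      exact mul_le_of_le_one_left (en_nonneg U _)
        (mul_le_one₀ (hb _) (norm_nonneg _) (hb _))
    · refine tendsto_const_nhds.congr' ?_
      filter_upwards [eventually_ge_atTop ⌈1 + ‖x‖ + T⌉₊] with n hn
      have h1 : 1 + ‖x‖ + T ≤ n := (Nat.le_ceil _).trans (by exact_mod_cast hn)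
      have : Real.smoothTransition (n - ‖x‖ - T) = 1 :=
        Real.smoothTransition.one_of_one_le (by linarith)
      simp [annulus, this]
  refine le_of_tendsto hlim (Eventually.of_forall fun n => ?_)
  refine (hU.annulus_energy_le hd hR hT).trans ?_
  have hi : Integrable fun x => Real.smoothTransition (‖x‖ - R) * en U (x, 0) :=
    (hU.integrable 0).bdd_mul (c := 1) (continuous_smoothTransition_norm R).aestronglyMeasurable
      (Eventually.of_forall fun x => hb _)
  refine integral_mono_of_nonneg (Eventually.of_forall fun x =>
    mul_nonneg (annulus_nonneg _ _ _) (en_nonneg U _)) hi (Eventually.of_forall fun x => ?_)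
  refine mul_le_mul_of_nonneg_right ?_ (en_nonneg U _)
  simp only [annulus, sub_zero]
  exact mul_le_of_le_one_right (Real.smoothTransition.nonneg _) (Real.smoothTransition.le_one _)

lemma Wave.exists_exterior_le (hd : 3 ≤ d) (hU : Wave U E) {ε : ℝ} (hε : 0 < ε) :
    ∃ R : ℝ, 1 ≤ R ∧ ∀ t, 0 ≤ t → ∫ x in {x | t + R ≤ ‖x‖}, en U (x, t) ≤ ε := by
  have hlim : Tendsto (fun n : ℕ => ∫ x, Real.smoothTransition (‖x‖ - n) * en U (x, 0)) atTop
      (𝓝 (∫ _x : Sp d, (0 : ℝ))) := by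
    refine tendsto_integral_of_dominated_convergence (fun x => en U (x, 0)) (fun n => ?_)
      (hU.integrable 0) (fun n => Eventually.of_forall fun x => ?_)
      (Eventually.of_forall fun x => ?_)
    · exact (continuous_smoothTransition_norm _).aestronglyMeasurable.mul (hU.integrable 0).1
    · rw [norm_mul, Real.norm_of_nonneg (en_nonneg U _),
        Real.norm_of_nonneg (Real.smoothTransition.nonneg _)]
      exact mul_le_of_le_one_left (en_nonneg U _) (Real.smoothTransition.le_one _)
    · refine tendsto_const_nhds.congr' ?_
      filter_upwards [eventually_ge_atTop ⌈‖x‖⌉₊] with n hn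
      have h1 : ‖x‖ ≤ n := (Nat.le_ceil _).trans (by exact_mod_cast hn)
      simp [Real.smoothTransition.zero_of_nonpos (by linarith : ‖x‖ - n ≤ 0)]
  rw [integral_zero] at hlim
  obtain ⟨n, hn, hn2⟩ := ((hlim.eventually_le_const hε).and (eventually_ge_atTop 2)).exists
  have hn2' : (2 : ℝ) ≤ n := by exact_mod_cast hn2
  refine ⟨n + 1, by linarith, fun t ht => ?_⟩
  refine le_trans ?_ ((hU.exterior_transition_le hd hn2' ht).trans hn)
  have hms : MeasurableSet {x : Sp d | t + (n + 1) ≤ ‖x‖} :=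
    measurableSet_le measurable_const measurable_norm
  rw [← integral_indicator hms]
  refine integral_mono_of_nonneg (Eventually.of_forall fun x =>
    indicator_nonneg (fun x _ => en_nonneg U _) x) ?_ (Eventually.of_forall fun x => ?_)
  · have := continuous_smoothTransition_norm (d := d) (t + n)
    refine (hU.integrable t).bdd_mul (c := 1) (f := fun x => Real.smoothTransition (‖x‖ - t - n))
      ?_ (Eventually.of_forall fun x => ?_)
    · simpa only [sub_sub] using this.aestronglyMeasurable
    · rw [Real.norm_of_nonneg (Real.smoothTransition.nonneg _)]
      exact Real.smoothTransition.le_one _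
  · by_cases hx : x ∈ {x : Sp d | t + (n + 1) ≤ ‖x‖}
    · have : 1 ≤ ‖x‖ - t - n := by
        have : t + (n + 1) ≤ ‖x‖ := hx
        linarith
      simp [indicator_of_mem hx, Real.smoothTransition.one_of_one_le this]
    · simp only [indicator_of_notMem hx]
      exact mul_nonneg (Real.smoothTransition.nonneg _) (en_nonneg U _)

/-- A plateau function, equal to `1` on `(-1, 1)` and to `0` outside `[-2, 2]`, with its first two
derivatives and a common bound `D` for them. -/
structure Plateau (ψ ψ1 ψ2 : ℝ → ℝ) (D : ℝ) : Prop where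
  hψ : ∀ y, HasDerivAt ψ (ψ1 y) y
  hψ1 : ∀ y, HasDerivAt ψ1 (ψ2 y) y
  cont2 : Continuous ψ2
  nonneg : ∀ y, 0 ≤ ψ y
  le_one : ∀ y, ψ y ≤ 1
  inner : ∀ y, |y| < 1 → ψ y = 1 ∧ ψ1 y = 0 ∧ ψ2 y = 0
  outer : ∀ y, 2 < |y| → ψ y = 0 ∧ ψ1 y = 0 ∧ ψ2 y = 0
  bound1 : ∀ y, |ψ1 y| ≤ D
  bound2 : ∀ y, |ψ2 y| ≤ D

lemma exists_plateau : ∃ (ψ ψ1 ψ2 : ℝ → ℝ) (D : ℝ), Plateau ψ ψ1 ψ2 D := by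
  let ψ : ContDiffBump (0 : ℝ) := ⟨1, 2, by norm_num, by norm_num⟩
  have hc : ContDiff ℝ 2 ψ := ψ.contDiff
  have hs1 : HasCompactSupport (deriv ψ) := ψ.hasCompactSupport.deriv
  have hs2 : HasCompactSupport (deriv (deriv ψ)) := hs1.deriv
  have hc1 : ContDiff ℝ 1 (deriv ψ) := ContDiff.iterate_deriv' 1 1 hc
  have hc2 : Continuous (deriv (deriv ψ)) := hc1.continuous_deriv le_rfl
  obtain ⟨D1, hD1⟩ := hs1.exists_bound_of_continuous hc1.continuous
  obtain ⟨D2, hD2⟩ := hs2.exists_bound_of_continuous hc2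
  have key : ∀ (c : ℝ) (V : Set ℝ), IsOpen V → (∀ y ∈ V, ψ y = c) → ∀ y ∈ V,
      deriv ψ y = 0 ∧ deriv (deriv ψ) y = 0 := by
    intro c V hV h
    have h1 : ∀ y ∈ V, deriv ψ y = 0 := fun y hy => by
      have : ψ =ᶠ[𝓝 y] fun _ => c := by
        filter_upwards [hV.mem_nhds hy] with z hz using h z hz
      simpa using this.deriv_eq
    refine fun y hy => ⟨h1 y hy, ?_⟩
    have : deriv ψ =ᶠ[𝓝 y] fun _ => 0 := by
      filter_upwards [hV.mem_nhds hy] with z hz using h1 z hz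
    simpa using this.deriv_eq
  have hin : ∀ y ∈ {y : ℝ | |y| < 1}, ψ y = 1 := fun y hy =>
    ψ.one_of_mem_closedBall (by simpa using le_of_lt (show |y| < 1 from hy))
  have hout : ∀ y ∈ {y : ℝ | 2 < |y|}, ψ y = 0 := fun y hy =>
    ψ.zero_of_le_dist (by simpa using le_of_lt (show 2 < |y| from hy))
  exact ⟨ψ, deriv ψ, deriv (deriv ψ), max D1 D2,
    { hψ := fun y => (hc.differentiable (by norm_num) y).hasDerivAt
      hψ1 := fun y => (hc1.differentiable (by norm_num) y).hasDerivAt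
      cont2 := hc2
      nonneg := fun _ => ψ.nonneg
      le_one := fun _ => ψ.le_one
      inner := fun y hy => ⟨hin y hy, key 1 _ (isOpen_lt continuous_abs continuous_const) hin y hy⟩
      outer := fun y hy =>
        ⟨hout y hy, key 0 _ (isOpen_lt continuous_const continuous_abs) hout y hy⟩
      bound1 := fun y => (hD1 y).trans (le_max_left _ _)
      bound2 := fun y => (hD2 y).trans (le_max_right _ _) }⟩

/-- Scale-invariant bounds on a radial profile. -/
structure Bdd (C : ℝ) (g g1 h h1 h2 : ℝ → ℝ) : Prop where
  bg : ∀ s, 0 < s → |g s| ≤ C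
  bg' : ∀ s, 0 < s → √s * |g s| ≤ C
  bg1 : ∀ s, 0 < s → s * |g1 s| ≤ C
  bh : ∀ s, 0 < s → |h s| ≤ C
  bh' : ∀ s, 0 < s → √s * |h s| ≤ C
  bh1 : ∀ s, 0 < s → s * |h1 s| ≤ C
  bh2 : ∀ s, 0 < s → s ^ 2 * |h2 s| ≤ C

section

variable {g g1 h h1 h2 ψ ψ1 ψ2 : ℝ → ℝ} {C D : ℝ}

lemma Bdd.nonneg (b : Bdd C g g1 h h1 h2) : 0 ≤ C := (abs_nonneg _).trans (b.bg 1 one_pos)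

lemma Plateau.bound_nonneg (pl : Plateau ψ ψ1 ψ2 D) : 0 ≤ D := (abs_nonneg _).trans (pl.bound1 0)

lemma Plateau.continuous (pl : Plateau ψ ψ1 ψ2 D) : Continuous ψ :=
  continuous_iff_continuousAt.2 fun y => (pl.hψ y).continuousAt

lemma Plateau.continuous1 (pl : Plateau ψ ψ1 ψ2 D) : Continuous ψ1 :=
  continuous_iff_continuousAt.2 fun y => (pl.hψ1 y).continuousAt

/-- Logarithmic cutoff. -/
noncomputable def lc0 (ψ : ℝ → ℝ) (c s : ℝ) : ℝ := if 0 < s then ψ (c * Real.log s) else 0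

/-- First derivative of the logarithmic cutoff. -/
noncomputable def lc1 (ψ1 : ℝ → ℝ) (c s : ℝ) : ℝ :=
  if 0 < s then ψ1 (c * Real.log s) * (c / s) else 0

/-- Second derivative of the logarithmic cutoff. -/
noncomputable def lc2 (ψ1 ψ2 : ℝ → ℝ) (c s : ℝ) : ℝ :=
  if 0 < s then (ψ2 (c * Real.log s) * c ^ 2 - ψ1 (c * Real.log s) * c) / s ^ 2 else 0

lemma Plateau.hasDerivAt_lc0 (pl : Plateau ψ ψ1 ψ2 D) (c : ℝ) {s : ℝ} (hs : 0 < s) :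
    HasDerivAt (lc0 ψ c) (lc1 ψ1 c s) s := by
  have h1 : HasDerivAt (fun s => ψ (c * Real.log s)) (ψ1 (c * Real.log s) * (c * s⁻¹)) s :=
    (pl.hψ _).comp s ((Real.hasDerivAt_log hs.ne').const_mul c)
  simp only [lc1, if_pos hs, div_eq_mul_inv]
  refine h1.congr_of_eventuallyEq ?_
  filter_upwards [lt_mem_nhds hs] with y hy using by simp [lc0, if_pos hy]

lemma Plateau.hasDerivAt_lc1 (pl : Plateau ψ ψ1 ψ2 D) (c : ℝ) {s : ℝ} (hs : 0 < s) :
    HasDerivAt (lc1 ψ1 c) (lc2 ψ1 ψ2 c s) s := by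
  have h1 : HasDerivAt (fun s => ψ1 (c * Real.log s)) (ψ2 (c * Real.log s) * (c * s⁻¹)) s :=
    (pl.hψ1 _).comp s ((Real.hasDerivAt_log hs.ne').const_mul c)
  have h2 := h1.mul ((hasDerivAt_inv hs.ne').const_mul c)
  have h3 : lc2 ψ1 ψ2 c s = ψ2 (c * Real.log s) * (c * s⁻¹) * (c * s⁻¹)
      + ψ1 (c * Real.log s) * (c * -(s ^ 2)⁻¹) := by
    simp only [lc2, if_pos hs]; field_simp; ring
  rw [h3]
  refine h2.congr_of_eventuallyEq ?_
  filter_upwards [lt_mem_nhds hs] with y hy using by simp [lc1, if_pos hy, div_eq_mul_inv]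

lemma Plateau.continuousOn_lc2 (pl : Plateau ψ ψ1 ψ2 D) (c : ℝ) :
    ContinuousOn (lc2 ψ1 ψ2 c) (Ioi 0) := by
  have h1 : ContinuousOn (fun s => (ψ2 (c * Real.log s) * c ^ 2 - ψ1 (c * Real.log s) * c) / s ^ 2)
      (Ioi 0) := by
    have hl : ContinuousOn (fun s => c * Real.log s) (Ioi 0) :=
      continuousOn_const.mul (Real.continuousOn_log.mono fun s hs => (ne_of_gt hs))
    exact (((pl.cont2.comp_continuousOn hl).mul continuousOn_const).sub
      ((pl.continuous1.comp_continuousOn hl).mul continuousOn_const)).div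
      (continuousOn_id.pow 2) fun s hs => (pow_pos hs 2).ne'
  exact h1.congr fun s hs => by simp [lc2, if_pos (show 0 < s from hs)]

lemma Plateau.measurable_lc (pl : Plateau ψ ψ1 ψ2 D) (c : ℝ) :
    Measurable (lc0 ψ c) ∧ Measurable (lc1 ψ1 c) ∧ Measurable (lc2 ψ1 ψ2 c) := by
  have hl : Measurable fun s => c * Real.log s := Real.measurable_log.const_mul c
  have m0 := pl.continuous.measurable.comp hl
  have m1 := pl.continuous1.measurable.comp hl
  have m2 := pl.cont2.measurable.comp hl
  refine ⟨m0.ite measurableSet_Ioi measurable_const, ?_, ?_⟩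
  · exact (m1.mul (measurable_const.div measurable_id)).ite measurableSet_Ioi measurable_const
  · exact (((m2.mul_const _).sub (m1.mul_const _)).div (measurable_id.pow_const 2)).ite
      measurableSet_Ioi measurable_const

lemma Profile.cutoff (p : Profile g g1 h h1 h2) (pl : Plateau ψ ψ1 ψ2 D) (c : ℝ) :
    Profile (fun s => g s * lc0 ψ c s) (fun s => g1 s * lc0 ψ c s + g s * lc1 ψ1 c s)
      (fun s => h s * lc0 ψ c s) (fun s => h1 s * lc0 ψ c s + h s * lc1 ψ1 c s)
      (fun s => (h2 s * lc0 ψ c s + h1 s * lc1 ψ1 c s)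
        + (h1 s * lc1 ψ1 c s + h s * lc2 ψ1 ψ2 c s)) := by
  obtain ⟨m0, m1, m2⟩ := pl.measurable_lc c
  have c0 : ContinuousOn (lc0 ψ c) (Ioi 0) :=
    fun s hs => (pl.hasDerivAt_lc0 c hs).continuousAt.continuousWithinAt
  have c1 : ContinuousOn (lc1 ψ1 c) (Ioi 0) :=
    fun s hs => (pl.hasDerivAt_lc1 c hs).continuousAt.continuousWithinAt
  have cg : ContinuousOn g (Ioi 0) := fun s hs => (p.hg s hs).continuousAt.continuousWithinAt
  have ch : ContinuousOn h (Ioi 0) := fun s hs => (p.hh s hs).continuousAt.continuousWithinAt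
  have ch1 : ContinuousOn h1 (Ioi 0) := fun s hs => (p.hh1 s hs).continuousAt.continuousWithinAt
  exact
    { hg := fun s hs => (p.hg s hs).mul (pl.hasDerivAt_lc0 c hs)
      hh := fun s hs => (p.hh s hs).mul (pl.hasDerivAt_lc0 c hs)
      hh1 := fun s hs => ((p.hh1 s hs).mul (pl.hasDerivAt_lc0 c hs)).add
        ((p.hh s hs).mul (pl.hasDerivAt_lc1 c hs))
      cg1 := (p.cg1.mul c0).add (cg.mul c1)
      ch2 := ((p.ch2.mul c0).add (ch1.mul c1)).add ((ch1.mul c1).add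
        (ch.mul (pl.continuousOn_lc2 c)))
      mg := p.mg.mul m0
      mg1 := (p.mg1.mul m0).add (p.mg.mul m1)
      mh := p.mh.mul m0
      mh1 := (p.mh1.mul m0).add (p.mh.mul m1)
      mh2 := ((p.mh2.mul m0).add (p.mh1.mul m1)).add ((p.mh1.mul m1).add (p.mh.mul m2)) }

lemma abs_add_mul_le {a b x y A B X Y : ℝ} (ha : |a| ≤ A) (hx : |x| ≤ X) (hb : |b| ≤ B)
    (hy : |y| ≤ Y) : |a * x + b * y| ≤ A * X + B * Y := by
  refine (abs_add_le _ _).trans ?_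
  rw [abs_mul, abs_mul]
  exact add_le_add (mul_le_mul ha hx (abs_nonneg _) ((abs_nonneg _).trans ha))
    (mul_le_mul hb hy (abs_nonneg _) ((abs_nonneg _).trans hb))

lemma Bdd.cutoff (b : Bdd C g g1 h h1 h2) (pl : Plateau ψ ψ1 ψ2 D) {c : ℝ} (hc : 0 < c)
    (hc1 : c ≤ 1) :
    Bdd (C * (1 + 4 * D)) (fun s => g s * lc0 ψ c s)
      (fun s => g1 s * lc0 ψ c s + g s * lc1 ψ1 c s)
      (fun s => h s * lc0 ψ c s) (fun s => h1 s * lc0 ψ c s + h s * lc1 ψ1 c s)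
      (fun s => (h2 s * lc0 ψ c s + h1 s * lc1 ψ1 c s)
        + (h1 s * lc1 ψ1 c s + h s * lc2 ψ1 ψ2 c s)) := by
  have hC := b.nonneg
  have hD := pl.bound_nonneg
  have hCD : 0 ≤ C * D := mul_nonneg hC hD
  have z0 : ∀ s, 0 < s → |lc0 ψ c s| ≤ 1 := fun s hs => by
    simp only [lc0, if_pos hs]
    rw [abs_of_nonneg (pl.nonneg _)]; exact pl.le_one _
  have z1 : ∀ s, 0 < s → |s * lc1 ψ1 c s| ≤ D := fun s hs => by
    simp only [lc1, if_pos hs]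
    rw [show s * (ψ1 (c * Real.log s) * (c / s)) = ψ1 (c * Real.log s) * c by field_simp, abs_mul,
      abs_of_pos hc]
    nlinarith [pl.bound1 (c * Real.log s), abs_nonneg (ψ1 (c * Real.log s))]
  have z2 : ∀ s, 0 < s → |s ^ 2 * lc2 ψ1 ψ2 c s| ≤ 2 * D := fun s hs => by
    simp only [lc2, if_pos hs]
    rw [mul_div_cancel₀ _ (pow_pos hs 2).ne']
    refine (abs_sub _ _).trans ?_
    rw [abs_mul, abs_mul, abs_of_pos hc, abs_of_pos (pow_pos hc 2)]
    have : c ^ 2 ≤ 1 := pow_le_one₀ hc.le hc1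
    nlinarith [pl.bound1 (c * Real.log s), abs_nonneg (ψ1 (c * Real.log s)),
      pl.bound2 (c * Real.log s), abs_nonneg (ψ2 (c * Real.log s))]
  have e0 : ∀ f : ℝ → ℝ, ∀ w : ℝ → ℝ, (∀ s, 0 < s → 0 ≤ w s) → (∀ s, 0 < s → w s * |f s| ≤ C) →
      ∀ s, 0 < s → w s * |f s * lc0 ψ c s| ≤ C * (1 + 4 * D) := by
    intro f w hw hf s hs
    rw [abs_mul, ← mul_assoc]
    have := mul_le_mul (hf s hs) (z0 s hs) (abs_nonneg _) hC
    linarith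
  have e1 : ∀ f f1 : ℝ → ℝ, (∀ s, 0 < s → |f s| ≤ C) → (∀ s, 0 < s → s * |f1 s| ≤ C) →
      ∀ s, 0 < s → s * |f1 s * lc0 ψ c s + f s * lc1 ψ1 c s| ≤ C * (1 + 4 * D) := by
    intro f f1 hf hf1 s hs
    rw [← abs_of_pos hs, ← abs_mul, abs_of_pos hs]
    rw [show s * (f1 s * lc0 ψ c s + f s * lc1 ψ1 c s)
      = (s * f1 s) * lc0 ψ c s + f s * (s * lc1 ψ1 c s) by ring]
    have h3 : |s * f1 s| ≤ C := by rw [abs_mul, abs_of_pos hs]; exact hf1 s hs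
    have := abs_add_mul_le h3 (z0 s hs) (hf s hs) (z1 s hs)
    linarith
  refine ⟨?_, e0 g (fun s => √s) (fun s _ => Real.sqrt_nonneg s) b.bg', e1 g g1 b.bg b.bg1,
    ?_, e0 h (fun s => √s) (fun s _ => Real.sqrt_nonneg s) b.bh', e1 h h1 b.bh b.bh1, ?_⟩
  · simpa using e0 g (fun _ => 1) (fun _ _ => zero_le_one) (by simpa using b.bg)
  · simpa using e0 h (fun _ => 1) (fun _ _ => zero_le_one) (by simpa using b.bh)
  · intro s hs
    have hs2 : 0 < s ^ 2 := pow_pos hs 2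
    rw [← abs_of_pos hs2, ← abs_mul]
    rw [show s ^ 2 * ((h2 s * lc0 ψ c s + h1 s * lc1 ψ1 c s)
        + (h1 s * lc1 ψ1 c s + h s * lc2 ψ1 ψ2 c s))
      = ((s ^ 2 * h2 s) * lc0 ψ c s + (s * h1 s) * (s * lc1 ψ1 c s))
        + ((s * h1 s) * (s * lc1 ψ1 c s) + h s * (s ^ 2 * lc2 ψ1 ψ2 c s)) by ring]
    have k1 : |s * h1 s| ≤ C := by rw [abs_mul, abs_of_pos hs]; exact b.bh1 s hs
    have k2 : |s ^ 2 * h2 s| ≤ C := by rw [abs_mul, abs_of_pos hs2]; exact b.bh2 s hs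
    have a1 := abs_add_mul_le k2 (z0 s hs) k1 (z1 s hs)
    have a2 := abs_add_mul_le k1 (z1 s hs) (b.bh s hs) (z2 s hs)
    refine (abs_add_le _ _).trans ?_
    linarith

lemma Plateau.lc_outer (pl : Plateau ψ ψ1 ψ2 D) {c : ℝ} (hc : 0 < c) {s : ℝ}
    (hs : s ∉ Icc (Real.exp (-(2 / c))) (Real.exp (2 / c))) : lc0 ψ c s = 0 ∧ lc1 ψ1 c s = 0 := by
  by_cases h0 : 0 < s
  · have : 2 < |c * Real.log s| := by
      by_contra! hle
      rw [abs_le] at hle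
      refine hs ⟨?_, ?_⟩
      · rw [← Real.le_log_iff_exp_le h0, ← neg_div, div_le_iff₀ hc]; linarith
      · rw [← Real.log_le_iff_le_exp h0, le_div_iff₀ hc]; linarith
    simp [lc0, lc1, pl.outer _ this]
  · simp [lc0, lc1, h0]

lemma Plateau.lc_inner (pl : Plateau ψ ψ1 ψ2 D) {s : ℝ} (hs : 0 < s) :
    ∀ᶠ n : ℕ in atTop, lc0 ψ (1 / (n + 1)) s = 1 ∧ lc1 ψ1 (1 / (n + 1)) s = 0 ∧
      lc2 ψ1 ψ2 (1 / (n + 1)) s = 0 := by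
  filter_upwards [eventually_ge_atTop ⌈|Real.log s|⌉₊] with n hn
  have h1 : |Real.log s| ≤ n := (Nat.le_ceil _).trans (by exact_mod_cast hn)
  have hn0 : (0 : ℝ) < n + 1 := by positivity
  have : |1 / ((n : ℝ) + 1) * Real.log s| < 1 := by
    rw [abs_mul, abs_of_pos (by positivity), one_div_mul_eq_div, div_lt_one hn0]
    linarith
  obtain ⟨i0, i1, i2⟩ := pl.inner _ this
  simp only [lc0, lc1, lc2, if_pos hs, i0, i1, i2]
  simp

end

/-- The scale-invariant quadratic density controlling all multiplier densities. -/
noncomputable def quad (U : Sp d × ℝ → ℝ) (q : Sp d × ℝ) : ℝ :=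
  dt U q ^ 2 + gsq U q + U q ^ 2 / ‖q.1‖ + U q ^ 2 / sr q

section

variable {g g1 h h1 h2 : ℝ → ℝ} {C : ℝ}

lemma abs_mul_le_half {a b A B : ℝ} (hA : |a| ≤ A) (hB : |b| ≤ B) :
    |a * b| ≤ (A ^ 2 + B ^ 2) / 2 := by
  rw [abs_mul]
  nlinarith [mul_le_mul hA hB (abs_nonneg _) ((abs_nonneg _).trans hA), sq_nonneg (A - B)]

lemma sqrt_sr (q : Sp d × ℝ) : √(sr q) = ‖q.1‖ := Real.sqrt_sq (norm_nonneg _)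

lemma abs_rad_le (U : Sp d × ℝ → ℝ) (q : Sp d × ℝ) : |rad U q| ≤ ‖q.1‖ * √(gsq U q) := by
  rw [← sqrt_sr, ← Real.sqrt_mul (show 0 ≤ sr q from sq_nonneg _)]
  exact Real.abs_le_sqrt (rad_sq_le U q)

lemma Bdd.abs_mom_le (b : Bdd C g g1 h h1 h2) (U : Sp d × ℝ → ℝ) {q : Sp d × ℝ} (hq : q.1 ≠ 0) :
    |mom U g h q| ≤ C * quad U q := by
  have hs := sr_pos hq
  have hr : 0 < ‖q.1‖ := norm_pos_iff.2 hq
  have hC := b.nonneg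
  have hgs := gsq_nonneg U q
  have k1 : |g (sr q) * rad U q| ≤ C * √(gsq U q) := by
    rw [abs_mul]
    have hb := b.bg' _ hs
    rw [sqrt_sr] at hb
    calc |g (sr q)| * |rad U q| ≤ |g (sr q)| * (‖q.1‖ * √(gsq U q)) :=
          mul_le_mul_of_nonneg_left (abs_rad_le U q) (abs_nonneg _)
      _ = (‖q.1‖ * |g (sr q)|) * √(gsq U q) := by ring
      _ ≤ _ := mul_le_mul_of_nonneg_right hb (Real.sqrt_nonneg _)
  have k2 : |h (sr q) * U q| ≤ C * (|U q| / ‖q.1‖) := by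
    rw [abs_mul, ← mul_div_assoc, le_div_iff₀ hr]
    have hb := b.bh' _ hs
    rw [sqrt_sr] at hb
    nlinarith [mul_le_mul_of_nonneg_right hb (abs_nonneg (U q))]
  have k3 : |mom U g h q| ≤ |dt U q| * (C * √(gsq U q) + C * (|U q| / ‖q.1‖)) := by
    rw [mom, abs_mul]
    exact mul_le_mul_of_nonneg_left ((abs_add_le _ _).trans (add_le_add k1 k2)) (abs_nonneg _)
  have e1 : √(gsq U q) ^ 2 = gsq U q := Real.sq_sqrt hgs
  have e2 : (|U q| / ‖q.1‖) ^ 2 = U q ^ 2 / sr q := by rw [div_pow, sq_abs]; rfl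
  have e3 : |dt U q| ^ 2 = dt U q ^ 2 := sq_abs _
  have e4 : 0 ≤ U q ^ 2 / ‖q.1‖ := by positivity
  have k4 : |dt U q| * (√(gsq U q) + |U q| / ‖q.1‖) ≤ quad U q := by
    unfold quad
    nlinarith [sq_nonneg (|dt U q| - √(gsq U q)), sq_nonneg (|dt U q| - |U q| / ‖q.1‖),
      sq_nonneg (√(gsq U q)), sq_nonneg (|U q| / ‖q.1‖)]
  calc _ ≤ _ := k3
    _ = C * (|dt U q| * (√(gsq U q) + |U q| / ‖q.1‖)) := by ring
    _ ≤ _ := mul_le_mul_of_nonneg_left k4 hC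

lemma abs_dens_le (U : Sp d × ℝ → ℝ) {q : Sp d × ℝ} (hq : q.1 ≠ 0) {G G1 H H1 H2 : ℝ}
    (bG : |G| ≤ C) (bG1 : sr q * |G1| ≤ C) (bH : |H| ≤ C) (bH1 : sr q * |H1| ≤ C)
    (bH2 : sr q ^ 2 * |H2| ≤ C) : |dens U q G G1 H H1 H2| ≤ (d + 5) * C * quad U q := by
  have hs := sr_pos hq
  have hr : 0 < ‖q.1‖ := norm_pos_iff.2 hq
  have hC : 0 ≤ C := (abs_nonneg _).trans bG
  have hgs := gsq_nonneg U q
  have bg := abs_le.1 bG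
  have bh := abs_le.1 bH
  have bg1 : |sr q * G1| ≤ C := by rw [abs_mul, abs_of_pos hs]; exact bG1
  have bh1 : |sr q * H1| ≤ C := by rw [abs_mul, abs_of_pos hs]; exact bH1
  have bh2 : |sr q ^ 2 * H2| ≤ C := by rw [abs_mul, abs_of_pos (pow_pos hs 2)]; exact bH2
  set s := sr q with hsd
  set κ := (d * G + 2 * s * G1) / 2 with hκd
  have hd0 : (0 : ℝ) ≤ d := Nat.cast_nonneg d
  have hdC : 0 ≤ d * C := mul_nonneg hd0 hC
  have dg1 := mul_le_mul_of_nonneg_left bg.1 hd0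
  have dg2 := mul_le_mul_of_nonneg_left bg.2 hd0
  have bg1'' := abs_le.1 bg1
  have hκ1 : -(d * C + 2 * C) / 2 ≤ κ := by rw [hκd]; linarith
  have hκ2 : κ ≤ (d * C + 2 * C) / 2 := by rw [hκd]; linarith
  have n1 : |(H - κ) * dt U q ^ 2| ≤ (d + 5) * C * dt U q ^ 2 := by
    rw [abs_mul, abs_of_nonneg (sq_nonneg (dt U q))]
    refine mul_le_mul_of_nonneg_right (abs_le.2 ⟨?_, ?_⟩) (sq_nonneg _) <;> linarith
  have n2 : |(G + H - κ) * gsq U q| ≤ (d + 3) * C * gsq U q := by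
    rw [abs_mul, abs_of_nonneg hgs]
    refine mul_le_mul_of_nonneg_right (abs_le.2 ⟨?_, ?_⟩) hgs <;> linarith
  have n3 : |2 * G1 * rad U q ^ 2| ≤ 2 * C * gsq U q := by
    rw [abs_mul, abs_mul, abs_of_nonneg (sq_nonneg (rad U q)), abs_of_pos (two_pos (α := ℝ))]
    have a1 := mul_le_mul_of_nonneg_left (rad_sq_le U q) (abs_nonneg (G1))
    have a2 := mul_le_mul_of_nonneg_right bG1 hgs
    rw [← hsd] at a1
    linarith
  have n4 : |(d * H1 + 2 * s * H2) * U q ^ 2| ≤ (d + 5) * C * (U q ^ 2 / s) := by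
    have : (d * H1 + 2 * s * H2) * U q ^ 2
        = (d * (s * H1) + 2 * (s ^ 2 * H2)) * (U q ^ 2 / s) := by field_simp
    have hp : 0 ≤ U q ^ 2 / s := by positivity
    rw [this, abs_mul, abs_of_nonneg hp]
    have a1 := abs_le.1 bh1
    have a2 := abs_le.1 bh2
    have a3 := mul_le_mul_of_nonneg_left a1.1 hd0
    have a4 := mul_le_mul_of_nonneg_left a1.2 hd0
    refine mul_le_mul_of_nonneg_right (abs_le.2 ⟨?_, ?_⟩) hp <;> linarith
  have n5 : |(H - κ + G / 2) * (U q ^ 2 / ‖q.1‖)| ≤ (d + 5) * C * (U q ^ 2 / ‖q.1‖) := by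
    have hp : 0 ≤ U q ^ 2 / ‖q.1‖ := by positivity
    rw [abs_mul, abs_of_nonneg hp]
    refine mul_le_mul_of_nonneg_right (abs_le.2 ⟨?_, ?_⟩) hp <;> linarith
  have m1 := abs_le.1 n1
  have m2 := abs_le.1 n2
  have m3 := abs_le.1 n3
  have m4 := abs_le.1 n4
  have m5 := abs_le.1 n5
  unfold dens quad
  rw [← hsd, ← hκd, abs_le]
  constructor <;> linarith

lemma Bdd.abs_dens_le (b : Bdd C g g1 h h1 h2) (U : Sp d × ℝ → ℝ) {q : Sp d × ℝ} (hq : q.1 ≠ 0) :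
    |dens U q (g (sr q)) (g1 (sr q)) (h (sr q)) (h1 (sr q)) (h2 (sr q))|
      ≤ (d + 5) * C * quad U q :=
  have hs := sr_pos hq
  CoulombWave.abs_dens_le U hq (b.bg _ hs) (b.bg1 _ hs) (b.bh _ hs) (b.bh1 _ hs) (b.bh2 _ hs)

end

lemma Wave.exists_majorant (hd : 3 ≤ d) (hU : Wave U E) (a b : ℝ) :
    ∃ (B : ℝ → Sp d → ℝ) (I : ℝ), (∀ t, Integrable (B t) ∧ ∫ x, B t x = I) ∧
      ∀ t ∈ Icc a b, ∀ x : Sp d, x ≠ 0 → quad U (x, t) ≤ B t x := by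
  have hK : IsCompact (Metric.closedBall (0 : Sp d) 1 ×ˢ Icc a b) :=
    (isCompact_closedBall _ _).prod isCompact_Icc
  obtain ⟨M, hM⟩ := hK.exists_bound_of_continuousOn hU.cont.continuousOn
  let w : Sp d → ℝ := fun x => M ^ 2 * ‖x‖ ^ (-2 : ℝ)
  have hfr : Module.finrank ℝ (Sp d) = d := by simp
  have hd3 : (3 : ℝ) ≤ d := by exact_mod_cast hd
  have hw : Integrable ((Metric.ball (0 : Sp d) 1).indicator w) := by
    rw [integrable_indicator_iff measurableSet_ball]
    refine integrableOn_ball_of_norm_le_rpow (α := 2) (C := M ^ 2) (by omega)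
      (by rw [hfr]; linarith) (Eventually.of_forall fun x => ?_) ?_
    · rw [Real.norm_of_nonneg]
      positivity
    · exact ((measurable_norm.pow_const _).const_mul _).aestronglyMeasurable
  refine ⟨fun t x => 4 * en U (x, t) + (Metric.ball (0 : Sp d) 1).indicator w x,
    4 * E + ∫ x, (Metric.ball (0 : Sp d) 1).indicator w x,
    fun t => ⟨((hU.integrable t).const_mul 4).add hw, ?_⟩, fun t ht x hx => ?_⟩
  · rw [integral_add ((hU.integrable t).const_mul 4) hw, integral_const_mul, hU.energy]
  · have hr : 0 < ‖x‖ := norm_pos_iff.2 hx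
    have hen : quad U (x, t) = 2 * en U (x, t) + U (x, t) ^ 2 / ‖x‖ ^ 2 := by
      simp only [quad, en, sr]; ring
    have hp : U (x, t) ^ 2 / ‖x‖ ≤ 2 * en U (x, t) := by
      have := gsq_nonneg U (x, t)
      have e : U (x, t) ^ 2 / (2 * ‖x‖) = U (x, t) ^ 2 / ‖x‖ / 2 := by field_simp
      simp only [en, e]
      nlinarith [sq_nonneg (dt U (x, t))]
    have hen0 := en_nonneg U (x, t)
    simp only [hen]
    by_cases h1 : x ∈ Metric.ball (0 : Sp d) 1
    · rw [indicator_of_mem h1]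
      have hb : |U (x, t)| ≤ M := hM (x, t) ⟨Metric.ball_subset_closedBall h1, ht⟩
      have : U (x, t) ^ 2 / ‖x‖ ^ 2 ≤ w x := by
        simp only [w]
        rw [Real.rpow_neg hr.le, Real.rpow_two, div_eq_mul_inv]
        refine mul_le_mul_of_nonneg_right ?_ (by positivity)
        exact sq_le_sq' (by linarith [neg_abs_le (U (x, t))]) ((le_abs_self _).trans hb)
      linarith
    · rw [indicator_of_notMem h1]
      have h1' : 1 ≤ ‖x‖ := by simpa using h1
      have : U (x, t) ^ 2 / ‖x‖ ^ 2 ≤ U (x, t) ^ 2 / ‖x‖ := by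
        refine div_le_div_of_nonneg_left (sq_nonneg _) hr ?_
        nlinarith
      linarith

/-- The production density of a radial multiplier at a point. -/
noncomputable def prod (U : Sp d × ℝ → ℝ) (g g1 h h1 h2 : ℝ → ℝ) (q : Sp d × ℝ) : ℝ :=
  dens U q (g (sr q)) (g1 (sr q)) (h (sr q)) (h1 (sr q)) (h2 (sr q))

section

variable {g g1 h h1 h2 : ℝ → ℝ} {C : ℝ}

lemma Wave.measurable_mom (hU : Wave U E) (p : Profile g g1 h h1 h2) : Measurable (mom U g h) :=
  (measurable_dt U).mul (((p.mg.comp measurable_sr).mul (measurable_rad U)).add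
    ((p.mh.comp measurable_sr).mul hU.cont.measurable))

lemma Wave.measurable_prod (hU : Wave U E) (p : Profile g g1 h h1 h2) :
    Measurable (prod U g g1 h h1 h2) := by
  have a1 := p.mg
  have a2 := p.mg1
  have a3 := p.mh
  have a4 := p.mh1
  have a5 := p.mh2
  have a6 := measurable_sr (d := d)
  have a7 := measurable_gsq U
  have a8 := measurable_rad U
  have a9 := measurable_dt U
  have a10 := hU.cont.measurable
  have a11 := measurable_norm_fst (d := d)
  unfold prod dens
  fun_prop

lemma Wave.integrable_of_le_quad (hd : 3 ≤ d) (hU : Wave U E) {f : Sp d → ℝ} {t : ℝ}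
    (hf : Measurable f) (hb : ∀ x, x ≠ 0 → |f x| ≤ C * quad U (x, t)) (hC : 0 ≤ C) :
    Integrable f := by
  obtain ⟨B, I, hB, hq⟩ := hU.exists_majorant hd t t
  refine ((hB t).1.const_mul C).mono' hf.aestronglyMeasurable ?_
  filter_upwards [ae_ne_zero hd] with x hx
  exact (hb x hx).trans (mul_le_mul_of_nonneg_left (hq t (by simp) x hx) hC)

lemma Wave.integrable_prod (hd : 3 ≤ d) (hU : Wave U E) (p : Profile g g1 h h1 h2)
    (b : Bdd C g g1 h h1 h2) (t : ℝ) : Integrable fun x => prod U g g1 h h1 h2 (x, t) :=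
  hU.integrable_of_le_quad hd (measurable_slice (hU.measurable_prod p) t)
    (fun x hx => b.abs_dens_le U (q := (x, t)) hx)
    (mul_nonneg (by positivity) b.nonneg)

lemma stronglyMeasurable_integral {f : Sp d × ℝ → ℝ} (hf : Measurable f) :
    StronglyMeasurable fun t => ∫ x, f (x, t) :=
  hf.stronglyMeasurable.integral_prod_left'

/-- The radial multiplier identity in integrated form. -/
theorem Wave.multiplier_identity (hd : 3 ≤ d) (hU : Wave U E) (p : Profile g g1 h h1 h2)
    (b : Bdd C g g1 h h1 h2) {a c : ℝ} (hac : a ≤ c) :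
    IntervalIntegrable (fun t => ∫ x, prod U g g1 h h1 h2 (x, t)) volume a c ∧
    (∫ x, mom U g h (x, c)) - ∫ x, mom U g h (x, a)
      = ∫ t in a..c, ∫ x, prod U g g1 h h1 h2 (x, t) := by
  obtain ⟨B, I, hB, hq⟩ := hU.exists_majorant hd a c
  have hmeas := hU.measurable_prod p
  have hbd : ∀ {K} {f : Sp d × ℝ → ℝ}, 0 ≤ K → (∀ q, q.1 ≠ 0 → |f q| ≤ K * quad U q) →
      ∀ t ∈ Icc a c, ∀ᵐ x, ‖f (x, t)‖ ≤ K * B t x := by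
    intro K f hK hf t ht
    filter_upwards [ae_ne_zero hd] with x hx
    exact (hf (x, t) hx).trans (mul_le_mul_of_nonneg_left (hq t ht x hx) hK)
  have hbI : ∀ {K} {f : Sp d × ℝ → ℝ}, 0 ≤ K → (∀ q, q.1 ≠ 0 → |f q| ≤ K * quad U q) →
      ∀ t ∈ Icc a c, ‖∫ x, f (x, t)‖ ≤ K * I := by
    intro K f hK hf t ht
    refine (norm_integral_le_of_norm_le ((hB t).1.const_mul K) (hbd hK hf t ht)).trans ?_
    rw [integral_const_mul, (hB t).2]
  have hsub : ∀ t ∈ uIoc a c, t ∈ Icc a c := fun t ht => by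
    rw [uIoc_of_le hac] at ht
    exact Ioc_subset_Icc_self ht
  have hd5 : (0 : ℝ) ≤ d + 5 := by positivity
  refine ⟨?_, ?_⟩
  · refine (intervalIntegrable_const (c := (d + 5) * C * I)).mono_fun
      (stronglyMeasurable_integral hmeas).aestronglyMeasurable ?_
    filter_upwards [ae_restrict_mem measurableSet_uIoc] with t ht
    exact (hbI (mul_nonneg hd5 b.nonneg) (fun q hq => b.abs_dens_le U hq) t (hsub t ht)).trans
      (le_abs_self _)
  · obtain ⟨ψ, ψ1, ψ2, D, pl⟩ := exists_plateau
    let e : ℕ → ℝ := fun n => 1 / ((n : ℝ) + 1)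
    have he : ∀ n, 0 < e n := fun n => by positivity
    have he1 : ∀ n, e n ≤ 1 := fun n => by
      simp only [e]
      rw [div_le_one (by positivity)]
      linarith [(Nat.cast_nonneg n : (0 : ℝ) ≤ n)]
    have P := fun n => p.cutoff pl (e n)
    have b' := fun n => b.cutoff pl (he n) (he1 n)
    have hC' := (b' 0).nonneg
    have hid := fun n => hU.multiplier_identity_of_compact hd (P n) (Real.exp_pos (-(2 / e n)))
      (β := Real.exp (2 / e n)) (fun s hs => by
        obtain ⟨z0, z1⟩ := pl.lc_outer (he n) hs
        simp [z0, z1]) hac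
    have hmom : ∀ t ∈ Icc a c, Tendsto (fun n => ∫ x, mom U (fun s => g s * lc0 ψ (e n) s)
        (fun s => h s * lc0 ψ (e n) s) (x, t)) atTop (𝓝 (∫ x, mom U g h (x, t))) := by
      intro t ht
      refine tendsto_integral_of_dominated_convergence _ (fun n =>
        (measurable_slice (hU.measurable_mom (P n)) t).aestronglyMeasurable)
        ((hB t).1.const_mul (C * (1 + 4 * D)))
        (fun n => hbd hC' (fun q hq => (b' n).abs_mom_le U hq) t ht) ?_
      filter_upwards [ae_ne_zero hd] with x hx
      refine tendsto_const_nhds.congr' ?_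
      filter_upwards [pl.lc_inner (sr_pos (q := (x, t)) hx)] with n hn
      simp only [mom, e, hn.1, mul_one]
    have hprod : ∀ t ∈ Icc a c, Tendsto (fun n => ∫ x, prod U (fun s => g s * lc0 ψ (e n) s)
        (fun s => g1 s * lc0 ψ (e n) s + g s * lc1 ψ1 (e n) s)
        (fun s => h s * lc0 ψ (e n) s) (fun s => h1 s * lc0 ψ (e n) s + h s * lc1 ψ1 (e n) s)
        (fun s => (h2 s * lc0 ψ (e n) s + h1 s * lc1 ψ1 (e n) s)
          + (h1 s * lc1 ψ1 (e n) s + h s * lc2 ψ1 ψ2 (e n) s)) (x, t)) atTop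
        (𝓝 (∫ x, prod U g g1 h h1 h2 (x, t))) := by
      intro t ht
      refine tendsto_integral_of_dominated_convergence _ (fun n =>
        (measurable_slice (hU.measurable_prod (P n)) t).aestronglyMeasurable)
        ((hB t).1.const_mul ((d + 5) * (C * (1 + 4 * D))))
        (fun n => hbd (mul_nonneg hd5 hC') (fun q hq => (b' n).abs_dens_le U hq) t ht) ?_
      filter_upwards [ae_ne_zero hd] with x hx
      refine tendsto_const_nhds.congr' ?_
      filter_upwards [pl.lc_inner (sr_pos (q := (x, t)) hx)] with n hn
      simp only [prod, e, hn.1, hn.2.1, hn.2.2, mul_one, mul_zero, add_zero]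
    have hlim := (hmom c (right_mem_Icc.2 hac)).sub (hmom a (left_mem_Icc.2 hac))
    refine tendsto_nhds_unique hlim ?_
    simp only [hid]
    refine intervalIntegral.tendsto_integral_filter_of_dominated_convergence
      (fun _ => (d + 5) * (C * (1 + 4 * D)) * I) (Eventually.of_forall fun n =>
        (stronglyMeasurable_integral (hU.measurable_prod (P n))).aestronglyMeasurable)
      (Eventually.of_forall fun n => Eventually.of_forall fun t ht =>
        hbI (mul_nonneg hd5 hC') (fun q hq => (b' n).abs_dens_le U hq) t (hsub t ht))
      intervalIntegrable_const
      (Eventually.of_forall fun t ht => hprod t (hsub t ht))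

end

section

variable {C : ℝ} {f : Sp d × ℝ → ℝ}

lemma Wave.ae_le_en (hd : 3 ≤ d) (hb : ∀ q, q.1 ≠ 0 → |f q| ≤ C * en U q) (t : ℝ) :
    ∀ᵐ x, ‖f (x, t)‖ ≤ C * en U (x, t) := by
  filter_upwards [ae_ne_zero hd] with x hx using hb (x, t) hx

lemma Wave.integrable_of_le_en (hd : 3 ≤ d) (hU : Wave U E) (hf : Measurable f)
    (hb : ∀ q, q.1 ≠ 0 → |f q| ≤ C * en U q) (t : ℝ) : Integrable fun x => f (x, t) :=
  ((hU.integrable t).const_mul C).mono' (measurable_slice hf t).aestronglyMeasurable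
    (Wave.ae_le_en hd hb t)

lemma Wave.abs_integral_le_of_le_en (hd : 3 ≤ d) (hU : Wave U E)
    (hb : ∀ q, q.1 ≠ 0 → |f q| ≤ C * en U q) (t : ℝ) : |∫ x, f (x, t)| ≤ C * E := by
  have := norm_integral_le_of_norm_le ((hU.integrable t).const_mul C) (Wave.ae_le_en hd hb t)
  rwa [integral_const_mul, hU.energy] at this

lemma Wave.intervalIntegrable_of_le_en (hd : 3 ≤ d) (hU : Wave U E) (hf : Measurable f)
    (hb : ∀ q, q.1 ≠ 0 → |f q| ≤ C * en U q) (a b : ℝ) :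
    IntervalIntegrable (fun t => ∫ x, f (x, t)) volume a b :=
  (intervalIntegrable_const (c := C * E)).mono_fun
    (stronglyMeasurable_integral hf).aestronglyMeasurable
    (Eventually.of_forall fun t =>
      (hU.abs_integral_le_of_le_en hd hb t).trans (le_abs_self _))

end

lemma en_eq (U : Sp d × ℝ → ℝ) (q : Sp d × ℝ) :
    en U q = (gsq U q + dt U q ^ 2 + U q ^ 2 / ‖q.1‖) / 2 := by
  rw [en, mul_comm 2, ← div_div]; ring

lemma Wave.energy_nonneg (hU : Wave U E) : 0 ≤ E := by
  rw [← hU.energy 0]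
  exact integral_nonneg fun x => en_nonneg U _

/-- Inverse powers of the Japanese bracket, `s` being the square of the radius. -/
noncomputable def jb (n : ℕ) (s : ℝ) : ℝ := (√(1 + s) ^ n)⁻¹

lemma hasDerivAt_jb (n : ℕ) {s : ℝ} (hs : 0 < s) :
    HasDerivAt (jb n) (-(n / 2) * jb (n + 2) s) s := by
  have h0 : (0 : ℝ) < 1 + s := by linarith
  have hw : √(1 + s) ≠ 0 := (Real.sqrt_pos.2 h0).ne'
  have h1 := ((((hasDerivAt_id s).const_add 1).sqrt h0.ne').pow n).inv (pow_ne_zero n hw)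
  refine h1.congr_deriv ?_
  simp only [jb, id, Pi.pow_apply]
  cases n with
  | zero => simp
  | succ n =>
    simp only [Nat.add_sub_cancel]
    field_simp
    ring

lemma measurable_jb (n : ℕ) : Measurable (jb n) := by unfold jb; fun_prop

lemma continuousOn_jb (n : ℕ) : ContinuousOn (jb n) (Ioi 0) :=
  fun _ hs => (hasDerivAt_jb n hs).continuousAt.continuousWithinAt

lemma jb_pos (n : ℕ) {s : ℝ} (hs : 0 < s) : 0 < jb n s := by
  have h0 : (0 : ℝ) < 1 + s := by linarith
  have := Real.sqrt_pos.2 h0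
  unfold jb; positivity

lemma mul_jb (n : ℕ) {s : ℝ} (hs : 0 < s) : s * jb (n + 2) s = jb n s - jb (n + 2) s := by
  have h0 : (0 : ℝ) < 1 + s := by linarith
  have hw : √(1 + s) ≠ 0 := (Real.sqrt_pos.2 h0).ne'
  have h2 : √(1 + s) ^ 2 = 1 + s := Real.sq_sqrt h0.le
  simp only [jb]
  have : s = √(1 + s) ^ 2 - 1 := by linarith
  rw [pow_add]
  field_simp
  linarith

lemma jb_le_one (n : ℕ) {s : ℝ} (hs : 0 < s) : jb n s ≤ 1 :=
  inv_le_one_of_one_le₀ (one_le_pow₀ (Real.one_le_sqrt.2 (by linarith)))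

lemma sqrt_mul_jb_le {s : ℝ} (hs : 0 < s) : √s * jb 1 s ≤ 1 := by
  have h0 : (0 : ℝ) < 1 + s := by linarith
  simp only [jb, pow_one]
  rw [← div_eq_mul_inv, div_le_one (Real.sqrt_pos.2 h0)]
  exact Real.sqrt_le_sqrt (by linarith)

lemma morawetz_profile (d : ℕ) : Profile (jb 1) (fun s => -(1 / 2) * jb 3 s)
    (fun s => (d - 1) / 2 * jb 1 s + 1 / 2 * jb 3 s)
    (fun s => -(d - 1) / 4 * jb 3 s - 3 / 4 * jb 5 s)
    (fun s => 3 * (d - 1) / 8 * jb 5 s + 15 / 8 * jb 7 s) where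
  hg s hs := by simpa using hasDerivAt_jb 1 hs
  hh s hs := (((hasDerivAt_jb 1 hs).const_mul ((d - 1) / 2 : ℝ)).add
    ((hasDerivAt_jb 3 hs).const_mul (1 / 2 : ℝ))).congr_deriv (by push_cast; ring)
  hh1 s hs := (((hasDerivAt_jb 3 hs).const_mul (-(d - 1) / 4 : ℝ)).sub
    ((hasDerivAt_jb 5 hs).const_mul (3 / 4 : ℝ))).congr_deriv (by push_cast; ring)
  cg1 := continuousOn_const.mul (continuousOn_jb 3)
  ch2 := (continuousOn_const.mul (continuousOn_jb 5)).add
    (continuousOn_const.mul (continuousOn_jb 7))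
  mg := measurable_jb 1
  mg1 := (measurable_jb 3).const_mul _
  mh := ((measurable_jb 1).const_mul _).add ((measurable_jb 3).const_mul _)
  mh1 := ((measurable_jb 3).const_mul _).sub ((measurable_jb 5).const_mul _)
  mh2 := ((measurable_jb 5).const_mul _).add ((measurable_jb 7).const_mul _)

lemma morawetz_bdd (hd : 3 ≤ d) : Bdd (2 * d) (jb 1) (fun s => -(1 / 2) * jb 3 s)
    (fun s => (d - 1) / 2 * jb 1 s + 1 / 2 * jb 3 s)
    (fun s => -(d - 1) / 4 * jb 3 s - 3 / 4 * jb 5 s)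
    (fun s => 3 * (d - 1) / 8 * jb 5 s + 15 / 8 * jb 7 s) := by
  have hd3 : (3 : ℝ) ≤ d := by exact_mod_cast hd
  have key : ∀ s, 0 < s → 0 < jb 1 s ∧ 0 < jb 3 s ∧ 0 < jb 5 s ∧ 0 < jb 7 s ∧ jb 1 s ≤ 1 ∧
      jb 3 s ≤ jb 1 s ∧ √s * jb 1 s ≤ 1 ∧ s * jb 3 s ≤ 1 ∧ s * jb 5 s ≤ 1 ∧
      s ^ 2 * jb 5 s ≤ 1 ∧ s ^ 2 * jb 7 s ≤ 1 := by
    intro s hs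
    have p1 := jb_pos 1 hs
    have p3 := jb_pos 3 hs
    have p5 := jb_pos 5 hs
    have p7 := jb_pos 7 hs
    have m1 := mul_jb 1 hs
    have m3 := mul_jb 3 hs
    have m5 := mul_jb 5 hs
    norm_num at m1 m3 m5
    have q3 := mul_pos hs p3
    have q5 := mul_pos hs p5
    have q7 := mul_pos hs p7
    have l1 := jb_le_one 1 hs
    refine ⟨p1, p3, p5, p7, l1, by linarith, sqrt_mul_jb_le hs, by linarith, by linarith, ?_, ?_⟩
    · rw [pow_two, mul_assoc, m3, mul_sub]; linarith
    · rw [pow_two, mul_assoc, m5, mul_sub]; linarith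
  constructor <;> intro s hs <;>
    obtain ⟨p1, p3, p5, p7, l1, l3, s1, s3, s5, t5, t7⟩ := key s hs
  · rw [abs_of_pos p1]; linarith
  · rw [abs_of_pos p1]; linarith
  · rw [abs_mul, abs_of_pos p3, abs_of_neg (by norm_num)]; linarith
  · rw [abs_of_pos (by nlinarith)]; nlinarith
  · have hs0 := Real.sqrt_nonneg s
    rw [abs_of_pos (by nlinarith)]
    have : √s * jb 3 s ≤ √s * jb 1 s := mul_le_mul_of_nonneg_left l3 hs0
    nlinarith
  · rw [abs_of_neg (by nlinarith)]
    nlinarith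
  · rw [abs_of_pos (by nlinarith)]
    nlinarith

lemma morawetz_density_le (hd : 3 ≤ d) (U : Sp d × ℝ → ℝ) {q : Sp d × ℝ} (hq : q.1 ≠ 0) :
    prod U (jb 1) (fun s => -(1 / 2) * jb 3 s)
      (fun s => (d - 1) / 2 * jb 1 s + 1 / 2 * jb 3 s)
      (fun s => -(d - 1) / 4 * jb 3 s - 3 / 4 * jb 5 s)
      (fun s => 3 * (d - 1) / 8 * jb 5 s + 15 / 8 * jb 7 s) q
      ≤ -(1 / 2) * (jb 1 (sr q) * (U q ^ 2 / ‖q.1‖)) := by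
  have hd3 : (3 : ℝ) ≤ d := by exact_mod_cast hd
  have hs := sr_pos hq
  have p3 := jb_pos 3 hs
  have p5 := jb_pos 5 hs
  have p7 := jb_pos 7 hs
  have m1 := mul_jb 1 hs
  have m3 := mul_jb 3 hs
  have m5 := mul_jb 5 hs
  norm_num at m1 m3 m5
  have hgs := gsq_nonneg U q
  have hrad := rad_sq_le U q
  unfold prod dens
  set s := sr q
  have hκ : ((d - 1) / 2 * jb 1 s + 1 / 2 * jb 3 s)
      - (d * jb 1 s + 2 * s * (-(1 / 2) * jb 3 s)) / 2 = 0 := by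
    linear_combination (1 / 2) * m1
  have hκ' : jb 1 s + ((d - 1) / 2 * jb 1 s + 1 / 2 * jb 3 s)
      - (d * jb 1 s + 2 * s * (-(1 / 2) * jb 3 s)) / 2 = jb 1 s := by
    linear_combination (1 / 2) * m1
  have hu : d * (-(d - 1) / 4 * jb 3 s - 3 / 4 * jb 5 s)
      + 2 * s * (3 * (d - 1) / 8 * jb 5 s + 15 / 8 * jb 7 s)
      = -((d - 1) * (d - 3) / 4 * jb 3 s + (6 * d - 18) / 4 * jb 5 s + 15 / 4 * jb 7 s) := by
    linear_combination (3 * (d - 1) / 4 : ℝ) * m3 + (15 / 4 : ℝ) * m5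
  have hu0 : 0 ≤ (d - 1) * (d - 3) / 4 * jb 3 s + (6 * d - 18) / 4 * jb 5 s + 15 / 4 * jb 7 s := by
    have a1 : (0 : ℝ) ≤ (d - 1) * (d - 3) / 4 := by
      have : (0 : ℝ) ≤ (d - 1) * (d - 3) := mul_nonneg (by linarith) (by linarith)
      linarith
    have a2 : (0 : ℝ) ≤ (6 * d - 18) / 4 := by linarith
    positivity
  have hr : jb 3 s * rad U q ^ 2 ≤ jb 1 s * gsq U q := by
    calc jb 3 s * rad U q ^ 2 ≤ jb 3 s * (s * gsq U q) := mul_le_mul_of_nonneg_left hrad p3.le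
      _ = (jb 1 s - jb 3 s) * gsq U q := by rw [← m1]; ring
      _ ≤ _ := mul_le_mul_of_nonneg_right (by linarith) hgs
  rw [hκ', hu, hκ]
  have := mul_nonneg hu0 (sq_nonneg (U q))
  linarith

lemma morawetz_mom_le (hd : 3 ≤ d) (U : Sp d × ℝ → ℝ) {q : Sp d × ℝ} (hq : q.1 ≠ 0) :
    |mom U (jb 1) (fun s => (d - 1) / 2 * jb 1 s + 1 / 2 * jb 3 s) q| ≤ (2 + d ^ 2) * en U q := by
  have hd3 : (3 : ℝ) ≤ d := by exact_mod_cast hd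
  have hs := sr_pos hq
  have hr : 0 < ‖q.1‖ := norm_pos_iff.2 hq
  have hgs := gsq_nonneg U q
  have p1 := jb_pos 1 hs
  have p3 := jb_pos 3 hs
  have m1 := mul_jb 1 hs
  norm_num at m1
  have l31 : jb 3 (sr q) ≤ jb 1 (sr q) := by nlinarith [mul_pos hs p3]
  have k1 : |jb 1 (sr q) * rad U q| ≤ √(gsq U q) := by
    rw [abs_mul, abs_of_pos p1]
    have h1 := sqrt_mul_jb_le hs
    rw [sqrt_sr] at h1
    calc jb 1 (sr q) * |rad U q| ≤ jb 1 (sr q) * (‖q.1‖ * √(gsq U q)) :=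
          mul_le_mul_of_nonneg_left (abs_rad_le U q) p1.le
      _ = (‖q.1‖ * jb 1 (sr q)) * √(gsq U q) := by ring
      _ ≤ _ := mul_le_of_le_one_left (Real.sqrt_nonneg _) h1
  have hj : jb 1 (sr q) ^ 2 ≤ 1 / ‖q.1‖ := by
    simp only [jb, pow_one, inv_pow]
    rw [Real.sq_sqrt (by linarith), inv_eq_one_div]
    refine one_div_le_one_div_of_le hr ?_
    simp only [sr]
    nlinarith [sq_nonneg (‖q.1‖ - 1)]
  have k2 : (((d - 1) / 2 * jb 1 (sr q) + 1 / 2 * jb 3 (sr q)) * U q) ^ 2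
      ≤ d ^ 2 / 4 * (U q ^ 2 / ‖q.1‖) := by
    have a0 : 0 ≤ (d - 1) / 2 * jb 1 (sr q) + 1 / 2 * jb 3 (sr q) := by
      have : (0 : ℝ) ≤ (d - 1) / 2 := by linarith
      positivity
    have a1 : (d - 1) / 2 * jb 1 (sr q) + 1 / 2 * jb 3 (sr q) ≤ d / 2 * jb 1 (sr q) := by linarith
    calc _ = ((d - 1) / 2 * jb 1 (sr q) + 1 / 2 * jb 3 (sr q)) ^ 2 * U q ^ 2 := mul_pow _ _ _
      _ ≤ (d / 2 * jb 1 (sr q)) ^ 2 * U q ^ 2 :=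
          mul_le_mul_of_nonneg_right (pow_le_pow_left₀ a0 a1 2) (sq_nonneg _)
      _ = d ^ 2 / 4 * (jb 1 (sr q) ^ 2 * U q ^ 2) := by ring
      _ ≤ d ^ 2 / 4 * (1 / ‖q.1‖ * U q ^ 2) := by gcongr
      _ = _ := by ring
  have e1 := abs_mul_le_half (le_refl |dt U q|) k1
  have e2 := abs_mul_le_half (le_refl |dt U q|)
    (le_refl |((d - 1) / 2 * jb 1 (sr q) + 1 / 2 * jb 3 (sr q)) * U q|)
  rw [sq_abs, Real.sq_sqrt hgs] at e1
  rw [sq_abs, sq_abs] at e2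
  have hp : 0 ≤ U q ^ 2 / ‖q.1‖ := by positivity
  have h0 := sq_nonneg (dt U q)
  rw [mom, mul_add, en_eq]
  refine (abs_add_le _ _).trans ?_
  nlinarith [mul_nonneg (sq_nonneg (d : ℝ)) h0, mul_nonneg (sq_nonneg (d : ℝ)) hgs,
    mul_nonneg (sq_nonneg (d : ℝ)) hp]

/-- The weighted potential density controlled by the Morawetz estimate. -/
noncomputable def wpot (U : Sp d × ℝ → ℝ) (q : Sp d × ℝ) : ℝ := jb 1 (sr q) * (U q ^ 2 / ‖q.1‖)

lemma Wave.measurable_wpot (hU : Wave U E) : Measurable (wpot U) :=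
  ((measurable_jb 1).comp measurable_sr).mul
    ((hU.cont.measurable.pow_const 2).div measurable_norm_fst)

lemma abs_wpot_le (U : Sp d × ℝ → ℝ) {q : Sp d × ℝ} (hq : q.1 ≠ 0) :
    |wpot U q| ≤ 2 * en U q := by
  have hs := sr_pos hq
  have hp : 0 ≤ U q ^ 2 / ‖q.1‖ := by positivity
  rw [wpot, abs_of_nonneg (mul_nonneg (jb_pos 1 hs).le hp), en_eq]
  have := mul_le_of_le_one_left hp (jb_le_one 1 hs)
  linarith [gsq_nonneg U q, sq_nonneg (dt U q)]

/-- The Morawetz estimate. -/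
lemma Wave.morawetz (hd : 3 ≤ d) (hU : Wave U E) {T : ℝ} (hT : 0 ≤ T) :
    ∫ t in (0 : ℝ)..T, ∫ x, wpot U (x, t) ≤ 4 * (2 + d ^ 2) * E := by
  have p := morawetz_profile d
  have b := morawetz_bdd hd
  obtain ⟨hii, hid⟩ := hU.multiplier_identity hd p b hT
  have h1 := fun t => abs_le.1 (hU.abs_integral_le_of_le_en hd
    (fun q hq => morawetz_mom_le hd U hq) t)
  have hle : ∫ t in (0 : ℝ)..T, ∫ x, prod U (jb 1) (fun s => -(1 / 2) * jb 3 s)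
      (fun s => (d - 1) / 2 * jb 1 s + 1 / 2 * jb 3 s)
      (fun s => -(d - 1) / 4 * jb 3 s - 3 / 4 * jb 5 s)
      (fun s => 3 * (d - 1) / 8 * jb 5 s + 15 / 8 * jb 7 s) (x, t)
      ≤ ∫ t in (0 : ℝ)..T, -(1 / 2) * ∫ x, wpot U (x, t) := by
    refine intervalIntegral.integral_mono_on hT hii ((hU.intervalIntegrable_of_le_en hd
      hU.measurable_wpot (fun q hq => abs_wpot_le U hq) 0 T).const_mul _) fun t _ => ?_
    rw [← integral_const_mul]
    refine integral_mono_ae (hU.integrable_prod hd p b t) ((hU.integrable_of_le_en hd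
      hU.measurable_wpot (fun q hq => abs_wpot_le U hq) t).const_mul _) ?_
    filter_upwards [ae_ne_zero hd] with x hx using morawetz_density_le hd U (q := (x, t)) hx
  rw [intervalIntegral.integral_const_mul] at hle
  linarith [(h1 0).1, (h1 0).2, (h1 T).1, (h1 T).2]

/-- If `m ≥ 0` has bounded primitive then `∫₀ᵀ (A + t) m(t) dt = o(T)`. -/
lemma exists_weighted_average_le {m : ℝ → ℝ} {C A ε : ℝ} (hm : ∀ t, 0 ≤ m t)
    (hi : ∀ a b, IntervalIntegrable m volume a b) (hC : ∀ T, 0 ≤ T → ∫ t in (0 : ℝ)..T, m t ≤ C)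
    (hA : 0 ≤ A) (hε : 0 < ε) :
    ∃ T₁, 0 < T₁ ∧ ∀ T, T₁ ≤ T → ∫ t in (0 : ℝ)..T, (A + t) * m t ≤ ε * T := by
  let F : ℝ → ℝ := fun T => ∫ t in (0 : ℝ)..T, m t
  let S := F '' Ici 0
  have hS : BddAbove S := ⟨C, by rintro _ ⟨T, hT, rfl⟩; exact hC T hT⟩
  have hne : S.Nonempty := ⟨_, mem_image_of_mem F self_mem_Ici⟩
  obtain ⟨_, ⟨T₀, hT₀, rfl⟩, hlt⟩ := exists_lt_of_lt_csSup hne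
    (show sSup S - ε / 2 < sSup S by linarith)
  have hT₀ : 0 ≤ T₀ := hT₀
  have hC0 : 0 ≤ C := by simpa using hC 0 le_rfl
  refine ⟨T₀ + 1 + (2 / ε) * ((A + T₀) * C + A * (ε / 2)), by positivity, fun T hT => ?_⟩
  have hX : 0 ≤ (A + T₀) * C + A * (ε / 2) := by positivity
  have hTX : (A + T₀) * C + A * (ε / 2) ≤ ε / 2 * T := by
    have : ε / 2 * ((2 / ε) * ((A + T₀) * C + A * (ε / 2))) = (A + T₀) * C + A * (ε / 2) := by
      field_simp
    rw [← this]
    exact mul_le_mul_of_nonneg_left (by linarith) (by positivity)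
  have hT₀T : T₀ ≤ T := by
    have : 0 ≤ (2 / ε) * ((A + T₀) * C + A * (ε / 2)) := by positivity
    linarith
  have hT : 0 ≤ T := hT₀.trans hT₀T
  have hi' : ∀ a b, IntervalIntegrable (fun t => (A + t) * m t) volume a b := fun a b =>
    (hi a b).continuousOn_mul (by fun_prop)
  have hsplit := intervalIntegral.integral_add_adjacent_intervals (hi' 0 T₀) (hi' T₀ T)
  have hF := intervalIntegral.integral_add_adjacent_intervals (hi 0 T₀) (hi T₀ T)
  have hsup : F T ≤ sSup S := le_csSup hS (mem_image_of_mem F (show T ∈ Ici 0 from hT))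
  have h1 : ∫ t in (0 : ℝ)..T₀, (A + t) * m t ≤ (A + T₀) * F T₀ := by
    rw [← intervalIntegral.integral_const_mul]
    exact intervalIntegral.integral_mono_on hT₀ (hi' _ _) ((hi _ _).const_mul _) fun t ht =>
      mul_le_mul_of_nonneg_right (by linarith [ht.2]) (hm t)
  have h2 : ∫ t in T₀..T, (A + t) * m t ≤ (A + T) * ∫ t in T₀..T, m t := by
    rw [← intervalIntegral.integral_const_mul]
    exact intervalIntegral.integral_mono_on hT₀T (hi' _ _) ((hi _ _).const_mul _) fun t ht =>
      mul_le_mul_of_nonneg_right (by linarith [ht.2]) (hm t)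
  have h3 : ∫ t in T₀..T, m t ≤ ε / 2 := by
    have : F T₀ + ∫ t in T₀..T, m t = F T := hF
    linarith
  have h4 : (A + T₀) * F T₀ ≤ (A + T₀) * C := mul_le_mul_of_nonneg_left (hC T₀ hT₀) (by linarith)
  have h5 : (A + T) * ∫ t in T₀..T, m t ≤ (A + T) * (ε / 2) :=
    mul_le_mul_of_nonneg_left h3 (by linarith)
  linarith

/-- Twice the potential energy density. -/
noncomputable def pot (U : Sp d × ℝ → ℝ) (q : Sp d × ℝ) : ℝ := U q ^ 2 / ‖q.1‖

lemma pot_nonneg (U : Sp d × ℝ → ℝ) (q : Sp d × ℝ) : 0 ≤ pot U q := by unfold pot; positivity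

lemma Wave.measurable_pot (hU : Wave U E) : Measurable (pot U) :=
  (hU.cont.measurable.pow_const 2).div measurable_norm_fst

lemma pot_le (U : Sp d × ℝ → ℝ) (q : Sp d × ℝ) : pot U q ≤ 2 * en U q := by
  rw [en_eq, pot]
  linarith [gsq_nonneg U q, sq_nonneg (dt U q)]

lemma abs_pot_le (U : Sp d × ℝ → ℝ) (q : Sp d × ℝ) : |pot U q| ≤ 2 * en U q := by
  rw [abs_of_nonneg (pot_nonneg U q)]; exact pot_le U q

lemma pot_le_wpot (U : Sp d × ℝ → ℝ) {q : Sp d × ℝ} {A : ℝ} (hq : ‖q.1‖ ≤ A) :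
    pot U q ≤ (1 + A) * wpot U q := by
  have h0 : (0 : ℝ) < 1 + sr q := by unfold sr; positivity
  have hw : √(1 + sr q) ≤ 1 + A := by
    rw [Real.sqrt_le_left (by linarith [norm_nonneg q.1]), sr]
    nlinarith [norm_nonneg q.1]
  have : 1 ≤ (1 + A) * jb 1 (sr q) := by
    simp only [jb, pow_one]
    rw [← div_eq_mul_inv, one_le_div (Real.sqrt_pos.2 h0)]
    exact hw
  rw [wpot, ← mul_assoc]
  exact le_mul_of_one_le_left (pot_nonneg U q) this

lemma Wave.exists_potential_average_le (hd : 3 ≤ d) (hU : Wave U E) {ε : ℝ} (hε : 0 < ε) :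
    ∃ T₁, 0 < T₁ ∧ ∀ T, T₁ ≤ T → ∫ t in (0 : ℝ)..T, ∫ x, pot U (x, t) ≤ ε * T := by
  obtain ⟨R, hR, hext⟩ := hU.exists_exterior_le hd (show 0 < ε / 4 by linarith)
  have hw0 : ∀ t, 0 ≤ ∫ x, wpot U (x, t) := fun t => by
    refine integral_nonneg_of_ae ?_
    filter_upwards [ae_ne_zero hd] with x hx
    exact mul_nonneg (jb_pos 1 (sr_pos (q := (x, t)) hx)).le (pot_nonneg U (x, t))
  have hwi := hU.intervalIntegrable_of_le_en hd hU.measurable_wpot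
    (fun q hq => abs_wpot_le U hq)
  have hpi := hU.intervalIntegrable_of_le_en hd hU.measurable_pot (fun q _ => abs_pot_le U q)
  obtain ⟨T₁, hT₁, hav⟩ := exists_weighted_average_le (A := 1 + R) hw0 hwi
    (fun T hT => hU.morawetz hd hT) (by linarith) (show 0 < ε / 2 by linarith)
  refine ⟨T₁, hT₁, fun T hT => ?_⟩
  have hT0 : 0 ≤ T := hT₁.le.trans hT
  have hpt : ∀ t ∈ Icc 0 T, ∫ x, pot U (x, t) ≤ (1 + R + t) * (∫ x, wpot U (x, t)) + ε / 2 := by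
    intro t ht
    have hms : MeasurableSet {x : Sp d | t + R ≤ ‖x‖} :=
      measurableSet_le measurable_const measurable_norm
    have hwint := hU.integrable_of_le_en hd hU.measurable_wpot (fun q hq => abs_wpot_le U hq) t
    have hind := (hU.integrable t).indicator hms
    have : ∫ x, pot U (x, t) ≤ ∫ x, ((1 + R + t) * wpot U (x, t)
        + 2 * {x : Sp d | t + R ≤ ‖x‖}.indicator (fun x => en U (x, t)) x) := by
      refine integral_mono_ae (hU.integrable_of_le_en hd hU.measurable_pot
        (fun q _ => abs_pot_le U q) t) ((hwint.const_mul _).add (hind.const_mul 2)) ?_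
      filter_upwards [ae_ne_zero hd] with x hx
      by_cases h : x ∈ {x : Sp d | t + R ≤ ‖x‖}
      · rw [indicator_of_mem h]
        have := mul_nonneg (jb_pos 1 (sr_pos (q := (x, t)) hx)).le (pot_nonneg U (x, t))
        have : 0 ≤ (1 + R + t) * wpot U (x, t) := mul_nonneg (by linarith [ht.1]) this
        linarith [pot_le U (x, t)]
      · rw [indicator_of_notMem h]
        have h' : ‖x‖ ≤ R + t := by
          have : ¬ (t + R ≤ ‖x‖) := h
          linarith
        have := pot_le_wpot U (q := (x, t)) h'
        linarith
    rw [integral_add (hwint.const_mul _) (hind.const_mul 2), integral_const_mul,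
      integral_const_mul, integral_indicator hms] at this
    linarith [hext t ht.1]
  have hwi' : IntervalIntegrable (fun t => (1 + R + t) * ∫ x, wpot U (x, t)) volume 0 T :=
    (hwi 0 T).continuousOn_mul (by fun_prop)
  have := intervalIntegral.integral_mono_on hT0 (hpi 0 T)
    (hwi'.add intervalIntegrable_const) hpt
  rw [intervalIntegral.integral_add hwi' intervalIntegrable_const,
    intervalIntegral.integral_const, smul_eq_mul] at this
  linarith [hav T hT]

section

variable {ψ ψ1 ψ2 : ℝ → ℝ} {D : ℝ}

lemma Plateau.dilation_profile (pl : Plateau ψ ψ1 ψ2 D) (k b : ℝ) :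
    Profile (fun s => ψ (b * s)) (fun s => b * ψ1 (b * s)) (fun s => k * ψ (b * s))
      (fun s => k * (b * ψ1 (b * s))) (fun s => k * (b * (b * ψ2 (b * s)))) := by
  have hb : ∀ s : ℝ, HasDerivAt (fun s => b * s) b s := fun s => by
    simpa using (hasDerivAt_id s).const_mul b
  have h0 : ∀ s, HasDerivAt (fun s => ψ (b * s)) (b * ψ1 (b * s)) s := fun s =>
    ((pl.hψ _).comp s (hb s)).congr_deriv (mul_comm _ _)
  have h1 : ∀ s, HasDerivAt (fun s => b * ψ1 (b * s)) (b * (b * ψ2 (b * s))) s := fun s =>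
    (((pl.hψ1 _).comp s (hb s)).congr_deriv (mul_comm _ _)).const_mul b
  have c0 := pl.continuous
  have c1 := pl.continuous1
  have c2 := pl.cont2
  exact
    { hg := fun s _ => h0 s
      hh := fun s _ => (h0 s).const_mul k
      hh1 := fun s _ => (h1 s).const_mul k
      cg1 := by fun_prop
      ch2 := by fun_prop
      mg := by fun_prop
      mg1 := by fun_prop
      mh := by fun_prop
      mh1 := by fun_prop
      mh2 := by fun_prop }

lemma Plateau.abs_le_one (pl : Plateau ψ ψ1 ψ2 D) (y : ℝ) : |ψ y| ≤ 1 := by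
  rw [abs_of_nonneg (pl.nonneg y)]; exact pl.le_one y

lemma Plateau.mul_abs_le (pl : Plateau ψ ψ1 ψ2 D) {b s : ℝ} (hb : 0 < b) (hs : 0 < s) :
    s * |b * ψ1 (b * s)| ≤ 2 * D ∧ s ^ 2 * |b * (b * ψ2 (b * s))| ≤ 4 * D := by
  have hbs : 0 < b * s := mul_pos hb hs
  have hD := pl.bound_nonneg
  by_cases h : 2 < |b * s|
  · obtain ⟨-, e1, e2⟩ := pl.outer _ h
    simp [e1, e2, hD]
  · rw [abs_of_pos hbs, not_lt] at h
    constructor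
    · rw [abs_mul, abs_of_pos hb]
      calc s * (b * |ψ1 (b * s)|) = (b * s) * |ψ1 (b * s)| := by ring
        _ ≤ 2 * D := mul_le_mul h (pl.bound1 _) (abs_nonneg _) (by norm_num)
    · rw [abs_mul, abs_mul, abs_of_pos hb]
      calc s ^ 2 * (b * (b * |ψ2 (b * s)|)) = (b * s) ^ 2 * |ψ2 (b * s)| := by ring
        _ ≤ 4 * D := mul_le_mul (by nlinarith) (pl.bound2 _) (abs_nonneg _) (by norm_num)

/-- A bound for the rescaled plateau multipliers and their scale-invariant derivatives. -/
noncomputable def dilConst (k D : ℝ) : ℝ := (1 + k) * (1 + 4 * D)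

lemma dilConst_bounds {k D : ℝ} (hk : 0 ≤ k) (hD : 0 ≤ D) : 1 ≤ dilConst k D ∧
    k ≤ dilConst k D ∧ 2 * D ≤ dilConst k D ∧ k * (2 * D) ≤ dilConst k D ∧
    k * (4 * D) ≤ dilConst k D := by
  have := mul_nonneg hk hD
  unfold dilConst
  refine ⟨?_, ?_, ?_, ?_, ?_⟩ <;> linarith

lemma Plateau.dilation_bounds (pl : Plateau ψ ψ1 ψ2 D) {k b s : ℝ} (hk : 0 ≤ k) (hb : 0 < b)
    (hs : 0 < s) : |ψ (b * s)| ≤ dilConst k D ∧ s * |b * ψ1 (b * s)| ≤ dilConst k D ∧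
      |k * ψ (b * s)| ≤ dilConst k D ∧ s * |k * (b * ψ1 (b * s))| ≤ dilConst k D ∧
      s ^ 2 * |k * (b * (b * ψ2 (b * s)))| ≤ dilConst k D := by
  obtain ⟨e1, e2, e3, e4, e5⟩ := dilConst_bounds hk pl.bound_nonneg
  obtain ⟨m1, m2⟩ := pl.mul_abs_le hb hs
  have h1 := pl.abs_le_one (b * s)
  refine ⟨h1.trans e1, m1.trans e3, ?_, ?_, ?_⟩
  · rw [abs_mul, abs_of_nonneg hk]
    exact (mul_le_of_le_one_right hk h1).trans e2
  · rw [abs_mul, abs_of_nonneg hk, mul_left_comm]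
    exact (mul_le_mul_of_nonneg_left m1 hk).trans e4
  · rw [abs_mul k, abs_of_nonneg hk, mul_left_comm]
    exact (mul_le_mul_of_nonneg_left m2 hk).trans e5

lemma Plateau.dilation_bdd (pl : Plateau ψ ψ1 ψ2 D) {k L : ℝ} (hk : 0 ≤ k) (hL : 0 < L) :
    Bdd (max (dilConst k D) ((1 + k) * (2 * L))) (fun s => ψ ((L ^ 2)⁻¹ * s))
      (fun s => (L ^ 2)⁻¹ * ψ1 ((L ^ 2)⁻¹ * s)) (fun s => k * ψ ((L ^ 2)⁻¹ * s))
      (fun s => k * ((L ^ 2)⁻¹ * ψ1 ((L ^ 2)⁻¹ * s)))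
      (fun s => k * ((L ^ 2)⁻¹ * ((L ^ 2)⁻¹ * ψ2 ((L ^ 2)⁻¹ * s)))) := by
  have hb : 0 < (L ^ 2)⁻¹ := by positivity
  have hbd := fun s (hs : 0 < s) => pl.dilation_bounds hk hb hs
  have hψ : ∀ s, 0 < s → √s * |ψ ((L ^ 2)⁻¹ * s)| ≤ 2 * L := by
    intro s hs
    by_cases h : 2 < |(L ^ 2)⁻¹ * s|
    · simp [(pl.outer _ h).1, hL.le]
    · rw [abs_of_pos (by positivity), not_lt, inv_mul_le_iff₀ (by positivity)] at h
      have : √s ≤ 2 * L := by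
        rw [Real.sqrt_le_left (by positivity)]; nlinarith [sq_nonneg L]
      exact (mul_le_of_le_one_right (Real.sqrt_nonneg s) (pl.abs_le_one _)).trans this
  have hkL := mul_nonneg hk hL.le
  constructor <;> intro s hs <;> obtain ⟨b1, b2, b3, b4, b5⟩ := hbd s hs
  · exact b1.trans (le_max_left _ _)
  · exact ((hψ s hs).trans (by linarith)).trans (le_max_right _ _)
  · exact b2.trans (le_max_left _ _)
  · exact b3.trans (le_max_left _ _)
  · refine le_trans ?_ (le_max_right _ _)
    rw [abs_mul, abs_of_nonneg hk, mul_left_comm]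
    have := mul_le_mul_of_nonneg_left (hψ s hs) hk
    linarith
  · exact b4.trans (le_max_left _ _)
  · exact b5.trans (le_max_left _ _)

/-- The energy density outside the ball of radius `ρ`. -/
noncomputable def ext (U : Sp d × ℝ → ℝ) (ρ : ℝ) (q : Sp d × ℝ) : ℝ :=
  if ρ ≤ ‖q.1‖ then en U q else 0

lemma ext_nonneg (U : Sp d × ℝ → ℝ) (ρ : ℝ) (q : Sp d × ℝ) : 0 ≤ ext U ρ q := by
  unfold ext; split_ifs <;> simp [en_nonneg]

lemma abs_ext_le (U : Sp d × ℝ → ℝ) (ρ : ℝ) (q : Sp d × ℝ) : |ext U ρ q| ≤ 1 * en U q := by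
  rw [abs_of_nonneg (ext_nonneg U ρ q), ext]; split_ifs <;> simp [en_nonneg]

lemma Wave.measurable_ext (hU : Wave U E) (ρ : ℝ) : Measurable (ext U ρ) :=
  Measurable.ite (measurableSet_le measurable_const measurable_norm_fst) hU.measurable_en
    measurable_const

lemma Wave.integral_ext_le (hU : Wave U E) {R ε ρ t : ℝ}
    (hext : ∀ t, 0 ≤ t → ∫ x in {x | t + R ≤ ‖x‖}, en U (x, t) ≤ ε) (ht : 0 ≤ t)
    (hρ : t + R ≤ ρ) : ∫ x, ext U ρ (x, t) ≤ ε := by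
  have hms : MeasurableSet {x : Sp d | ρ ≤ ‖x‖} :=
    measurableSet_le measurable_const measurable_norm
  have : ∀ x, ext U ρ (x, t) = {x : Sp d | ρ ≤ ‖x‖}.indicator (fun x => en U (x, t)) x :=
    fun x => by simp [ext, indicator_apply]
  simp_rw [this]
  rw [integral_indicator hms]
  exact (setIntegral_mono_set (hU.integrable t).integrableOn
    (Eventually.of_forall fun x => en_nonneg U _)
    (Eventually.of_forall fun x (hx : ρ ≤ ‖x‖) => hρ.trans hx)).trans (hext t ht)

lemma Plateau.dilation_density_le (pl : Plateau ψ ψ1 ψ2 D) (hd : 3 ≤ d) (U : Sp d × ℝ → ℝ)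
    {q : Sp d × ℝ} (hq : q.1 ≠ 0) {L : ℝ} (hL : 1 ≤ L) :
    prod U (fun s => ψ ((L ^ 2)⁻¹ * s))
      (fun s => (L ^ 2)⁻¹ * ψ1 ((L ^ 2)⁻¹ * s)) (fun s => (d - 1) / 2 * ψ ((L ^ 2)⁻¹ * s))
      (fun s => (d - 1) / 2 * ((L ^ 2)⁻¹ * ψ1 ((L ^ 2)⁻¹ * s)))
      (fun s => (d - 1) / 2 * ((L ^ 2)⁻¹ * ((L ^ 2)⁻¹ * ψ2 ((L ^ 2)⁻¹ * s)))) q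
      ≤ (1 / 2 * pot U q - en U q) + (4 * ((d + 5) * dilConst ((d - 1) / 2) D) + 1)
        * ext U L q := by
  have hd3 : (3 : ℝ) ≤ d := by exact_mod_cast hd
  have hs := sr_pos hq
  have hr : 0 < ‖q.1‖ := norm_pos_iff.2 hq
  have hL0 : 0 < L := by linarith
  have hk : (0 : ℝ) ≤ (d - 1) / 2 := by linarith
  have hb : 0 < (L ^ 2)⁻¹ := by positivity
  rw [ext]
  split_ifs with hLr
  · obtain ⟨b1, b2, b3, b4, b5⟩ := pl.dilation_bounds hk hb hs
    have h1 := (abs_le.1 (abs_dens_le U hq b1 b2 b3 b4 b5)).2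
    have h2 : quad U q ≤ 4 * en U q := by
      have : U q ^ 2 / sr q ≤ U q ^ 2 / ‖q.1‖ :=
        div_le_div_of_nonneg_left (sq_nonneg _) hr (by simp only [sr]; nlinarith)
      have h3 : 0 ≤ U q ^ 2 / ‖q.1‖ := by positivity
      rw [en_eq, quad]
      linarith [gsq_nonneg U q, sq_nonneg (dt U q)]
    have h3 := pot_nonneg U q
    have h4 : 0 ≤ (d + 5) * dilConst ((d - 1) / 2) D :=
      mul_nonneg (by linarith) ((abs_nonneg _).trans b1)
    have h5 := mul_le_mul_of_nonneg_left h2 h4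
    rw [prod]
    linarith
  · have h1 : |(L ^ 2)⁻¹ * sr q| < 1 := by
      rw [abs_of_pos (by positivity), inv_mul_lt_iff₀ (by positivity), sr]
      nlinarith [not_le.1 hLr]
    obtain ⟨i0, i1, i2⟩ := pl.inner _ h1
    rw [prod]
    simp only [i0, i1, i2, dens, en_eq, pot]
    apply le_of_eq
    ring

/-- The product of the lengths of the space and time derivatives. -/
noncomputable def cross (U : Sp d × ℝ → ℝ) (q : Sp d × ℝ) : ℝ := |dt U q| * √(gsq U q)

lemma cross_nonneg (U : Sp d × ℝ → ℝ) (q : Sp d × ℝ) : 0 ≤ cross U q := by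
  unfold cross; positivity

lemma en_sub_cross (U : Sp d × ℝ → ℝ) (q : Sp d × ℝ) :
    en U q - cross U q = ((|dt U q| - √(gsq U q)) ^ 2 + pot U q) / 2 := by
  rw [en_eq, cross, pot, sub_sq, Real.sq_sqrt (gsq_nonneg U q), sq_abs]
  ring

lemma cross_le_en (U : Sp d × ℝ → ℝ) (q : Sp d × ℝ) : cross U q ≤ en U q := by
  have := en_sub_cross U q
  nlinarith [sq_nonneg (|dt U q| - √(gsq U q)), pot_nonneg U q]

lemma abs_cross_le (U : Sp d × ℝ → ℝ) (q : Sp d × ℝ) : |cross U q| ≤ 1 * en U q := by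
  rw [abs_of_nonneg (cross_nonneg U q), one_mul]; exact cross_le_en U q

lemma measurable_cross (U : Sp d × ℝ → ℝ) : Measurable (cross U) :=
  ((measurable_dt U).norm).mul (measurable_gsq U).sqrt

lemma abs_mul_dt_le_en (U : Sp d × ℝ → ℝ) {q : Sp d × ℝ} (hq : q.1 ≠ 0) {L : ℝ} (hL : 0 < L)
    (hr : ‖q.1‖ ≤ 2 * L) : |dt U q| * |U q| ≤ 2 * √L * en U q := by
  have hr0 : 0 < ‖q.1‖ := norm_pos_iff.2 hq
  have hw := Real.sqrt_pos.2 hL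
  have hw2 := Real.sq_sqrt hL.le
  have h1 : U q ^ 2 ≤ 2 * L * pot U q := by
    rw [pot, mul_div_assoc', le_div_iff₀ hr0, mul_comm]
    exact mul_le_mul_of_nonneg_right hr (sq_nonneg _)
  have h2 : √L * (|dt U q| * |U q|) ≤ √L * (2 * √L * en U q) := by
    have h3 : en U q = (gsq U q + dt U q ^ 2 + pot U q) / 2 := en_eq U q
    have h5 : √L * (2 * √L * en U q) = 2 * L * en U q := by linear_combination 2 * en U q * hw2
    have h6 := two_mul_le_add_sq (√L * |dt U q|) (|U q|)
    rw [mul_pow, hw2, sq_abs, sq_abs] at h6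
    rw [h5, h3]
    nlinarith [mul_nonneg hL.le (gsq_nonneg U q), mul_nonneg hL.le (pot_nonneg U q)]
  exact le_of_mul_le_mul_left h2 hw

lemma Plateau.dilation_mom_le (pl : Plateau ψ ψ1 ψ2 D) (hd : 3 ≤ d) (U : Sp d × ℝ → ℝ)
    {q : Sp d × ℝ} (hq : q.1 ≠ 0) {L ρ : ℝ} (hL : 1 ≤ L) (hρ : 0 ≤ ρ) :
    |mom U (fun s => ψ ((L ^ 2)⁻¹ * s)) (fun s => (d - 1) / 2 * ψ ((L ^ 2)⁻¹ * s)) q|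
      ≤ ρ * cross U q + 2 * L * ext U ρ q + d * √L * en U q := by
  have hd3 : (3 : ℝ) ≤ d := by exact_mod_cast hd
  have hL0 : 0 < L := by linarith
  have hs := sr_pos hq
  have hf := cross_nonneg U q
  have he := en_nonneg U q
  have hi := ext_nonneg U ρ q
  have hρf := mul_nonneg hρ hf
  have hde : 0 ≤ d * √L * en U q := by positivity
  simp only [mom]
  by_cases h : 2 < |(L ^ 2)⁻¹ * sr q|
  · rw [(pl.outer _ h).1]
    simp only [zero_mul, mul_zero, add_zero, abs_zero]
    positivity
  · rw [abs_of_pos (by positivity), not_lt, inv_mul_le_iff₀ (by positivity)] at h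
    have hr : ‖q.1‖ ≤ 2 * L := by
      rw [← sqrt_sr, Real.sqrt_le_left (by positivity)]; nlinarith [sq_nonneg L]
    set p := ψ ((L ^ 2)⁻¹ * sr q)
    have hp0 : 0 ≤ p := pl.nonneg _
    have hp1 : p ≤ 1 := pl.le_one _
    have k1 : |dt U q| * (p * |rad U q|) ≤
        ρ * cross U q + 2 * L * ext U ρ q := by
      have : |dt U q| * (p * |rad U q|) ≤ ‖q.1‖ * cross U q := by
        calc |dt U q| * (p * |rad U q|) ≤ |dt U q| * (‖q.1‖ * √(gsq U q)) :=
              mul_le_mul_of_nonneg_left ((mul_le_of_le_one_left (abs_nonneg _) hp1).trans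
                (abs_rad_le U q)) (abs_nonneg _)
          _ = _ := by rw [cross]; ring
      refine this.trans ?_
      rw [ext]
      split_ifs with hc
      · have := mul_le_mul hr (cross_le_en U q) hf (by positivity)
        linarith
      · have := mul_le_mul_of_nonneg_right (not_le.1 hc).le hf
        linarith
    have k2 : |dt U q| * ((d - 1) / 2 * p * |U q|) ≤ d * √L * en U q := by
      have h1 := abs_mul_dt_le_en U hq hL0 hr
      have h2 : (d - 1) / 2 * p ≤ (d : ℝ) / 2 := by nlinarith
      have h3 : 0 ≤ |dt U q| * |U q| := by positivity
      calc |dt U q| * ((d - 1) / 2 * p * |U q|) = (d - 1) / 2 * p * (|dt U q| * |U q|) := by ring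
        _ ≤ d / 2 * (2 * √L * en U q) := mul_le_mul h2 h1 h3 (by positivity)
        _ = _ := by ring
    calc |dt U q * (p * rad U q + (d - 1) / 2 * p * U q)|
        ≤ |dt U q| * (|p * rad U q| + |(d - 1) / 2 * p * U q|) := by
          rw [abs_mul]; exact mul_le_mul_of_nonneg_left (abs_add_le _ _) (abs_nonneg _)
      _ = |dt U q| * (p * |rad U q|) + |dt U q| * ((d - 1) / 2 * p * |U q|) := by
          rw [abs_mul, abs_mul, abs_of_nonneg hp0,
            abs_of_nonneg (mul_nonneg (by linarith : (0 : ℝ) ≤ (d - 1) / 2) hp0), mul_add]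
      _ ≤ _ := add_le_add k1 k2

end

section

variable {ψ ψ1 ψ2 : ℝ → ℝ} {D : ℝ} {ε R L : ℝ}

lemma Wave.integral_dilation_mom_le (hd : 3 ≤ d) (hU : Wave U E) (pl : Plateau ψ ψ1 ψ2 D)
    (hext : ∀ t, 0 ≤ t → ∫ x in {x | t + R ≤ ‖x‖}, en U (x, t) ≤ ε) (hL : 1 ≤ L)
    {ρ t : ℝ} (hρ : 0 ≤ ρ) (ht : 0 ≤ t) (htρ : t + R ≤ ρ) :
    |∫ x, mom U (fun s => ψ ((L ^ 2)⁻¹ * s)) (fun s => (d - 1) / 2 * ψ ((L ^ 2)⁻¹ * s)) (x, t)|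
      ≤ ρ * (∫ x, cross U (x, t)) + 2 * L * ε + d * √L * E := by
  have i1 := (hU.integrable_of_le_en hd (measurable_cross U) (fun q _ => abs_cross_le U q)
    t).const_mul ρ
  have i2 := (hU.integrable_of_le_en hd (hU.measurable_ext ρ) (fun q _ => abs_ext_le U ρ q)
    t).const_mul (2 * L)
  have i3 := (hU.integrable t).const_mul (d * √L)
  have i12 : Integrable (fun x => ρ * cross U (x, t) + 2 * L * ext U ρ (x, t)) := i1.add i2
  have h := norm_integral_le_of_norm_le
    (f := fun x => mom U (fun s => ψ ((L ^ 2)⁻¹ * s))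
      (fun s => (d - 1) / 2 * ψ ((L ^ 2)⁻¹ * s)) (x, t)) (i12.add i3) (by
    filter_upwards [ae_ne_zero hd] with x hx
    exact pl.dilation_mom_le hd U (q := (x, t)) hx hL hρ)
  simp only [Pi.add_apply] at h
  rw [integral_add i12 i3, integral_add i1 i2, integral_const_mul, integral_const_mul,
    integral_const_mul, hU.energy] at h
  refine h.trans ?_
  have := mul_le_mul_of_nonneg_left (hU.integral_ext_le hext ht htρ)
    (show 0 ≤ 2 * L by linarith)
  linarith

lemma Wave.integral_dilation_prod_le (hd : 3 ≤ d) (hU : Wave U E) (pl : Plateau ψ ψ1 ψ2 D)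
    (hext : ∀ t, 0 ≤ t → ∫ x in {x | t + R ≤ ‖x‖}, en U (x, t) ≤ ε) (hL : 1 ≤ L)
    {t : ℝ} (ht : 0 ≤ t) (htL : t + R ≤ L) :
    ∫ x, prod U (fun s => ψ ((L ^ 2)⁻¹ * s))
      (fun s => (L ^ 2)⁻¹ * ψ1 ((L ^ 2)⁻¹ * s)) (fun s => (d - 1) / 2 * ψ ((L ^ 2)⁻¹ * s))
      (fun s => (d - 1) / 2 * ((L ^ 2)⁻¹ * ψ1 ((L ^ 2)⁻¹ * s)))
      (fun s => (d - 1) / 2 * ((L ^ 2)⁻¹ * ((L ^ 2)⁻¹ * ψ2 ((L ^ 2)⁻¹ * s)))) (x, t)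
      ≤ (1 / 2 * (∫ x, pot U (x, t)) - E)
        + (4 * ((d + 5) * dilConst ((d - 1) / 2) D) + 1) * ε := by
  have hd3 : (3 : ℝ) ≤ d := by exact_mod_cast hd
  have hk : (0 : ℝ) ≤ (d - 1) / 2 := by linarith
  have hK : 0 ≤ 4 * ((d + 5) * dilConst ((d - 1) / 2) D) + 1 := by
    have := (dilConst_bounds hk pl.bound_nonneg).1
    positivity
  have i1 := (hU.integrable_of_le_en hd hU.measurable_pot (fun q _ => abs_pot_le U q)
    t).const_mul (1 / 2)
  have i2 := (hU.integrable_of_le_en hd (hU.measurable_ext L) (fun q _ => abs_ext_le U L q)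
    t).const_mul (4 * ((d + 5) * dilConst ((d - 1) / 2) D) + 1)
  have i0 : Integrable (fun x => 1 / 2 * pot U (x, t) - en U (x, t)) := i1.sub (hU.integrable t)
  have hL0 : 0 < L := by linarith
  have h := integral_mono_ae (hU.integrable_prod hd (pl.dilation_profile _ _)
    (pl.dilation_bdd hk hL0) t) (i0.add i2) (by
    filter_upwards [ae_ne_zero hd] with x hx
    exact pl.dilation_density_le hd U (q := (x, t)) hx hL)
  simp only [Pi.add_apply] at h
  rw [integral_add i0 i2, integral_sub i1 (hU.integrable t),
    integral_const_mul, integral_const_mul, hU.energy] at h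
  have := mul_le_mul_of_nonneg_left (hU.integral_ext_le hext ht htL) hK
  linarith

lemma Wave.energy_mul_le (hd : 3 ≤ d) (hU : Wave U E) (pl : Plateau ψ ψ1 ψ2 D)
    (hext : ∀ t, 0 ≤ t → ∫ x in {x | t + R ≤ ‖x‖}, en U (x, t) ≤ ε) (hR : 1 ≤ R)
    {T : ℝ} (hT : 0 ≤ T) (hpot : ∫ t in (0 : ℝ)..T, ∫ x, pot U (x, t) ≤ ε * T) :
    T * E ≤ (1 / 2 + (4 * ((d + 5) * dilConst ((d - 1) / 2) D) + 1)) * ε * T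
      + (T + R) * (∫ x, cross U (x, T)) + R * E + 4 * (T + R) * ε + 2 * (d * √(T + R) * E) := by
  have hd3 : (3 : ℝ) ≤ d := by exact_mod_cast hd
  have hk : (0 : ℝ) ≤ (d - 1) / 2 := by linarith
  have hL : 1 ≤ T + R := by linarith
  obtain ⟨hi, hid⟩ := hU.multiplier_identity hd (pl.dilation_profile _ _)
    (pl.dilation_bdd hk (show 0 < T + R by linarith)) hT
  have hP := (hU.intervalIntegrable_of_le_en hd hU.measurable_pot
    (fun q _ => abs_pot_le U q) 0 T).const_mul (1 / 2)
  have hb := intervalIntegral.integral_mono_on hT hi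
    ((hP.sub intervalIntegrable_const).add intervalIntegrable_const)
    (fun t ht => hU.integral_dilation_prod_le hd pl hext hL ht.1 (by linarith [ht.2]))
  rw [intervalIntegral.integral_add (hP.sub intervalIntegrable_const) intervalIntegrable_const,
    intervalIntegral.integral_sub hP intervalIntegrable_const,
    intervalIntegral.integral_const_mul, intervalIntegral.integral_const,
    intervalIntegral.integral_const, smul_eq_mul, smul_eq_mul] at hb
  have m1 := (abs_le.1 (hU.integral_dilation_mom_le hd pl hext hL
    (show 0 ≤ T + R by linarith) hT le_rfl)).1
  have m2 := (abs_le.1 (hU.integral_dilation_mom_le hd pl hext hL (show 0 ≤ R by linarith)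
    le_rfl (zero_add R).le)).2
  have hc := (abs_le.1 (hU.abs_integral_le_of_le_en hd (fun q _ => abs_cross_le U q) 0)).2
  have hc' := mul_le_mul_of_nonneg_left hc (show 0 ≤ R by linarith)
  linarith

lemma Wave.eventually_energy_sub_cross_le (hd : 3 ≤ d) (hU : Wave U E) (hε : 0 < ε) :
    ∀ᶠ t in atTop, E - ∫ x, cross U (x, t) ≤ ε := by
  obtain ⟨ψ, ψ1, ψ2, D, pl⟩ := exists_plateau
  have hd3 : (3 : ℝ) ≤ d := by exact_mod_cast hd
  have hk : (0 : ℝ) ≤ (d - 1) / 2 := by linarith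
  have hE := hU.energy_nonneg
  set K := 1 / 2 + (4 * ((d + 5) * dilConst ((d - 1) / 2) D) + 1) with hKdef
  have hK : 0 < K := by
    have := (dilConst_bounds hk pl.bound_nonneg).1
    positivity
  set δ := ε / (2 * (K + 4)) with hδdef
  have hδ : 0 < δ := by positivity
  obtain ⟨R, hR, hext⟩ := hU.exists_exterior_le hd hδ
  obtain ⟨T₁, hT₁, hav⟩ := hU.exists_potential_average_le hd hδ
  have hlim : Tendsto (fun T : ℝ => (2 * R * E) * T⁻¹ + (4 * R * δ) * T⁻¹
      + (4 * d * E) * (√T)⁻¹) atTop (𝓝 0) := by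
    have h1 := tendsto_inv_atTop_zero (𝕜 := ℝ)
    have h2 := h1.comp Real.tendsto_sqrt_atTop
    simpa using ((h1.const_mul (2 * R * E)).add (h1.const_mul (4 * R * δ))).add
      (h2.const_mul (4 * d * E))
  filter_upwards [eventually_ge_atTop T₁, eventually_ge_atTop R,
    hlim.eventually_le_const (show 0 < ε / 2 by linarith)] with T hT1 hT2 hsmall
  have hT : 0 < T := by linarith
  have hmain := hU.energy_mul_le hd pl hext hR hT.le (hav T hT1)
  rw [← hKdef] at hmain
  have hc := (abs_le.1 (hU.abs_integral_le_of_le_en hd (fun q _ => abs_cross_le U q) T)).2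
  have hc' := mul_le_mul_of_nonneg_left hc (show 0 ≤ R by linarith)
  have hsq : √(T + R) ≤ 2 * √T := by
    rw [Real.sqrt_le_left (by positivity), mul_pow, Real.sq_sqrt hT.le]; linarith
  have hsq' : d * √(T + R) * E ≤ d * (2 * √T) * E :=
    mul_le_mul_of_nonneg_right (mul_le_mul_of_nonneg_left hsq (by linarith)) hE
  have hs2 : √T * √T = T := Real.mul_self_sqrt hT.le
  have hs0 : 0 < √T := Real.sqrt_pos.2 hT
  have e1 : T * ((2 * R * E) * T⁻¹ + (4 * R * δ) * T⁻¹ + (4 * d * E) * (√T)⁻¹) =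
      2 * R * E + 4 * R * δ + 4 * d * E * √T := by
    have : T * (√T)⁻¹ = √T := by
      rw [← div_eq_mul_inv, div_eq_iff hs0.ne', hs2]
    linear_combination (4 * d * E) * this + (2 * R * E + 4 * R * δ) * mul_inv_cancel₀ hT.ne'
  have e2 := mul_le_mul_of_nonneg_left hsmall hT.le
  rw [e1] at e2
  have e3 : (K + 4) * δ = ε / 2 := by rw [hδdef]; field_simp
  refine le_of_mul_le_mul_left ?_ hT
  have e4 : (K + 4) * δ * T = ε / 2 * T := by rw [e3]
  linarith

end

lemma defect_le (U : Sp d × ℝ → ℝ) (q : Sp d × ℝ) {η : ℝ} (hη : 0 < η) :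
    (|dt U q ^ 2 - gsq U q| + pot U q) / 2
      ≤ (1 / (2 * η) + 1) * (en U q - cross U q) + η * en U q := by
  have hg := gsq_nonneg U q
  have hp := pot_nonneg U q
  have h1 := en_sub_cross U q
  set a := |dt U q| with ha
  set b := √(gsq U q) with hb
  have hb2 : b ^ 2 = gsq U q := Real.sq_sqrt hg
  have ha2 : a ^ 2 = dt U q ^ 2 := sq_abs _
  have h2 : en U q = (gsq U q + dt U q ^ 2 + pot U q) / 2 := en_eq U q
  have h3 : |dt U q ^ 2 - gsq U q| ≤ (a - b) ^ 2 / (2 * η) + η * (a + b) ^ 2 / 2 := by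
    rw [← ha2, ← hb2, sq_sub_sq, abs_mul, ← sq_abs (a + b), ← sq_abs (a - b),
      div_add_div _ _ (by positivity) two_ne_zero, le_div_iff₀ (by positivity)]
    nlinarith [sq_nonneg (|a - b| - η * |a + b|)]
  have h4 : (a + b) ^ 2 ≤ 4 * en U q := by nlinarith [sq_nonneg (a - b)]
  have h5 : η * (a + b) ^ 2 / 2 ≤ 2 * (η * en U q) := by nlinarith
  have h6 : (a - b) ^ 2 / (2 * η) ≤ 2 * (en U q - cross U q) / (2 * η) :=
    div_le_div_of_nonneg_right (by linarith) (by positivity)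
  have h7 : 2 * (en U q - cross U q) / (2 * η)
      = 2 * (1 / (2 * η) * (en U q - cross U q)) := by ring
  have h8 : pot U q ≤ 2 * (en U q - cross U q) := by linarith [sq_nonneg (a - b)]
  linarith

lemma Wave.tendsto_integral (hd : 3 ≤ d) (hU : Wave U E) {f : Sp d × ℝ → ℝ} (hf : Measurable f)
    (hb : ∀ q, |f q - en U q| ≤ (|dt U q ^ 2 - gsq U q| + pot U q) / 2) :
    Tendsto (fun t => ∫ x, f (x, t)) atTop (𝓝 E) := by
  have hE := hU.energy_nonneg
  rw [Metric.tendsto_nhds]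
  intro ε hε
  set η := ε / (4 * (E + 1)) with hη
  have hη0 : 0 < η := by positivity
  set κ := 1 / (2 * η) + 1 with hκ
  have hκ0 : 0 < κ := by positivity
  filter_upwards [hU.eventually_energy_sub_cross_le hd (show 0 < ε / (4 * κ) by positivity)]
    with t ht
  have ic := hU.integrable_of_le_en hd (measurable_cross U) (fun q _ => abs_cross_le U q) t
  have ie := hU.integrable t
  have i1 := (ie.sub ic).const_mul κ
  have i2 := ie.const_mul η
  have hle : ∀ x, ‖f (x, t) - en U (x, t)‖ ≤
      κ * (en U (x, t) - cross U (x, t)) + η * en U (x, t) :=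
    fun x => (hb (x, t)).trans (defect_le U (x, t) hη0)
  have hsub : Integrable (fun x => f (x, t) - en U (x, t)) :=
    (i1.add i2).mono' ((measurable_slice hf t).sub
      (measurable_slice hU.measurable_en t)).aestronglyMeasurable (Eventually.of_forall hle)
  have hfi : Integrable (fun x => f (x, t)) :=
    (hsub.add ie).congr (Eventually.of_forall fun x => sub_add_cancel _ _)
  have h := norm_integral_le_of_norm_le (i1.add i2) (Eventually.of_forall hle)
  simp only [Pi.add_apply, Pi.sub_apply] at h
  have i1' : Integrable (fun x => κ * (en U (x, t) - cross U (x, t))) := i1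
  rw [integral_add i1' i2, integral_const_mul, integral_const_mul, integral_sub ie ic,
    integral_sub hfi ie, hU.energy] at h
  rw [Real.dist_eq]
  have h1 : κ * (E - ∫ x, cross U (x, t)) ≤ ε / 4 := by
    calc _ ≤ κ * (ε / (4 * κ)) := mul_le_mul_of_nonneg_left ht hκ0.le
      _ = ε / 4 := by field_simp
  have h2 : η * E ≤ ε / 4 := by
    rw [hη, div_mul_eq_mul_div, div_le_div_iff₀ (by positivity) (by norm_num)]
    nlinarith
  rw [Real.norm_eq_abs] at h
  linarith

lemma Wave.tendsto_dt (hd : 3 ≤ d) (hU : Wave U E) :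
    Tendsto (fun t => ∫ x, dt U (x, t) ^ 2) atTop (𝓝 E) := by
  refine hU.tendsto_integral hd ((measurable_dt U).pow_const 2) fun q => ?_
  have h2 : en U q = (gsq U q + dt U q ^ 2 + pot U q) / 2 := en_eq U q
  have h3 := pot_nonneg U q
  rw [h2, abs_le]
  constructor <;> linarith [le_abs_self (dt U q ^ 2 - gsq U q),
    neg_abs_le (dt U q ^ 2 - gsq U q)]

lemma Wave.tendsto_gsq (hd : 3 ≤ d) (hU : Wave U E) :
    Tendsto (fun t => ∫ x, gsq U (x, t)) atTop (𝓝 E) := by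
  refine hU.tendsto_integral hd (measurable_gsq U) fun q => ?_
  have h2 : en U q = (gsq U q + dt U q ^ 2 + pot U q) / 2 := en_eq U q
  have h3 := pot_nonneg U q
  rw [h2, abs_le]
  constructor <;> linarith [le_abs_self (dt U q ^ 2 - gsq U q),
    neg_abs_le (dt U q ^ 2 - gsq U q)]

lemma Wave.tendsto_gsq_add_pot (hd : 3 ≤ d) (hU : Wave U E) :
    Tendsto (fun t => ∫ x, (gsq U (x, t) + pot U (x, t))) atTop (𝓝 E) := by
  refine hU.tendsto_integral (f := fun q => gsq U q + pot U q) hd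
    ((measurable_gsq U).add hU.measurable_pot) fun q => ?_
  have h2 : en U q = (gsq U q + dt U q ^ 2 + pot U q) / 2 := en_eq U q
  have h3 := pot_nonneg U q
  rw [h2, abs_le]
  constructor <;> linarith [le_abs_self (dt U q ^ 2 - gsq U q),
    neg_abs_le (dt U q ^ 2 - gsq U q)]

end CoulombWave

/-- Energy-balance limits for finite-energy free Coulomb
waves: as `t → +∞`, `∫(|∇ₓu|² + u²/|x|) → E`, `∫|∇ₓu|² → E` and
`∫|∂ₜu|² → E`. -/
theorem stmt16 (d : ℕ) (hd : 3 ≤ d)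
    (u : EuclideanSpace ℝ (Fin d) → ℝ → ℝ) (E : ℝ)
    (hu : IsFreeCoulombWave u E) :
    Tendsto (fun t : ℝ =>
        ∫ x : EuclideanSpace ℝ (Fin d),
          (‖gradient (fun y => u y t) x‖ ^ 2 + (u x t) ^ 2 / ‖x‖))
      atTop (nhds E) ∧
    Tendsto (fun t : ℝ =>
        ∫ x : EuclideanSpace ℝ (Fin d), ‖gradient (fun y => u y t) x‖ ^ 2)
      atTop (nhds E) ∧
    Tendsto (fun t : ℝ =>
        ∫ x : EuclideanSpace ℝ (Fin d), (deriv (u x) t) ^ 2)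
      atTop (nhds E) := by
  have hU := CoulombWave.Wave.of_isFreeCoulombWave hd hu
  have hdiff : ∀ (x : EuclideanSpace ℝ (Fin d)) (t : ℝ), x ≠ 0 →
      DifferentiableAt ℝ (fun q : EuclideanSpace ℝ (Fin d) × ℝ => u q.1 q.2) (x, t) :=
    fun x t hx => (hU.contDiffAt_one hx).differentiableAt one_ne_zero
  refine ⟨(hU.tendsto_gsq_add_pot hd).congr fun t => integral_congr_ae ?_,
    (hU.tendsto_gsq hd).congr fun t => integral_congr_ae ?_,
    (hU.tendsto_dt hd).congr fun t => integral_congr_ae ?_⟩ <;>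
  filter_upwards [CoulombWave.ae_ne_zero hd] with x hx
  · rw [← CoulombWave.norm_gradient_sq (hdiff x t hx)]
    rfl
  · rw [← CoulombWave.norm_gradient_sq (hdiff x t hx)]
  · rw [← CoulombWave.deriv_time (hdiff x t hx)]
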